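/- Let d = 1 and p = p_c. There exists a constant K > 0 such that for every t ≥ 1, χ_t ≥ K · ξ_t · θ_t². -/

import Mathlib

/-!
Common set-up: nearest-neighbour oriented bond percolation on the space-time
lattice `ℤ^d × ℕ`.  A (potential) bond is a pair `((x, s), y)`, representing
the oriented bond from `(x, s)` to `(y, s + 1)` (it is a genuine bond when
`‖x - y‖₁ = 1`).  Each bond is occupied (`true`) with probability `p`,
independently of all other bonds.  The product Bernoulli(`p`) measure on
configurations is constructed explicitly as the pushforward of the uniform
measure on `[0,1)`: the binary digits of a uniform sample are i.i.d. fair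
coin flips, which are re-packed (via the pairing function) into an i.i.d.
sequence of uniform random variables `unif i`, one for each bond, and the
bond indexed by `i` is occupied exactly when `unif i < p`.
-/

open MeasureTheory Filter Set
open scoped Classical ENNReal Topology

namespace OrientedPercolation

/-- A potential bond of the `d`-dimensional space-time lattice: `((x, s), y)`
represents the oriented pair from `(x, s)` to `(y, s + 1)`. -/
abbrev Bond (d : ℕ) := ((Fin d → ℤ) × ℕ) × (Fin d → ℤ)

/-- A bond configuration: each potential bond is occupied (`true`) or vacant (`false`). -/
abbrev Config (d : ℕ) := Bond d → Bool

/-- The ℓ¹-norm of a point of `ℤ^d`. -/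
def norm1 {d : ℕ} (x : Fin d → ℤ) : ℤ := ∑ i, |x i|

/-- The squared Euclidean norm of a point of `ℤ^d`. -/
def normSq {d : ℕ} (x : Fin d → ℤ) : ℤ := ∑ i, (x i) ^ 2

/-- The `n`-th binary digit of `x ∈ [0,1)`. -/
noncomputable def digit (n : ℕ) (x : ℝ) : ℕ := ⌊x * 2 ^ (n + 1)⌋.toNat % 2

/-- From a single uniform sample on `[0,1)`, an i.i.d. sequence of uniform
samples on `[0,1]`, obtained by splitting the binary digits via the pairing
function. -/
noncomputable def unif (i : ℕ) (x : ℝ) : ℝ :=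
  ∑' k : ℕ, (digit (Nat.pair i k) x : ℝ) / 2 ^ (k + 1)

/-- An injective encoding of the bonds by natural numbers. -/
noncomputable def enc (d : ℕ) : Bond d → ℕ := (exists_injective_nat (Bond d)).choose

/-- The i.i.d. Bernoulli(`p`) bond configuration built from a uniform sample `x`. -/
noncomputable def config (d : ℕ) (p : ℝ) (x : ℝ) : Config d :=
  fun b => if unif (enc d b) x < p then true else false

/-- The product Bernoulli(`p`) measure `ℙ_p` on bond configurations. -/
noncomputable def P (d : ℕ) (p : ℝ) : Measure (Config d) :=
  Measure.map (config d p) ((volume : Measure ℝ).restrict (Set.Ico 0 1))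

/-- `ConnectedIn ω R x s y t` : either `(x,s) = (y,t) ∈ R`, or there is a path of
occupied bonds from `(x, s)` to `(y, t)`, all of whose vertices lie in `R`. -/
def ConnectedIn {d : ℕ} (ω : Config d) (R : Set ((Fin d → ℤ) × ℕ))
    (x : Fin d → ℤ) (s : ℕ) (y : Fin d → ℤ) (t : ℕ) : Prop :=
  (x = y ∧ s = t ∧ (x, s) ∈ R) ∨
  (s < t ∧ ∃ v : ℕ → (Fin d → ℤ), v s = x ∧ v t = y ∧
    (∀ j, s ≤ j → j ≤ t → (v j, j) ∈ R) ∧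
    (∀ j, s ≤ j → j < t → norm1 (v (j + 1) - v j) = 1 ∧ ω ((v j, j), v (j + 1)) = true))

/-- `(x, s) → (y, t)` : `(x,s) = (y,t)` or there is a path of occupied bonds from
`(x, s)` to `(y, t)`. -/
def Connected {d : ℕ} (ω : Config d) (x : Fin d → ℤ) (s : ℕ) (y : Fin d → ℤ) (t : ℕ) : Prop :=
  ConnectedIn ω Set.univ x s y t

/-- The survival probability `θ_t = ℙ_p((o,0) → t)`. -/
noncomputable def theta (d : ℕ) (p : ℝ) (t : ℕ) : ℝ :=
  (P d p {ω | ∃ y, Connected ω 0 0 y t}).toReal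

/-- The two-point function `τ(x,t) = ℙ_p((o,0) → (x,t))`. -/
noncomputable def tau (d : ℕ) (p : ℝ) (x : Fin d → ℤ) (t : ℕ) : ℝ :=
  (P d p {ω | Connected ω 0 0 x t}).toReal

/-- The expected number of vertices at time `t` connected from the origin,
`χ_t = Σ_x τ(x,t)`. -/
noncomputable def chi (d : ℕ) (p : ℝ) (t : ℕ) : ℝ := ∑' x : Fin d → ℤ, tau d p x t

/-- The gyration radius `ξ_t = (χ_t⁻¹ Σ_x |x|² τ(x,t))^(1/2)`. -/
noncomputable def xi (d : ℕ) (p : ℝ) (t : ℕ) : ℝ :=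
  Real.sqrt ((∑' x : Fin d → ℤ, (normSq x : ℝ) * tau d p x t) / chi d p t)

/-- The critical point `p_c = inf {p ∈ [0,1] : θ_∞ > 0}` (here `θ_∞ = lim_t θ_t = inf_t θ_t`,
since `θ_t` is nonincreasing in `t` and nonnegative). -/
noncomputable def pc (d : ℕ) : ℝ :=
  sInf {p ∈ Set.Icc (0 : ℝ) 1 | 0 < ⨅ t : ℕ, theta d p t}

/-- The rectangle `[a, b] × [0, t]` (for `d = 1`). -/
def rect (a b : ℤ) (t : ℕ) : Set ((Fin 1 → ℤ) × ℕ) :=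
  {v | a ≤ v.1 0 ∧ v.1 0 ≤ b ∧ v.2 ≤ t}

/-- The rectangle `[a, b] × [0, t]` is crossed vertically: there is a path of occupied
bonds inside the rectangle from some vertex `(x, 0)` to some vertex `(y, t)`. -/
def CrossedVert (ω : Config 1) (a b : ℤ) (t : ℕ) : Prop :=
  ∃ x y : Fin 1 → ℤ, ConnectedIn ω (rect a b t) x 0 y t

/-- The rectangle `[a, b] × [0, t]` is crossed from left to right: there is a path of
occupied bonds inside the rectangle containing a vertex with first coordinate `a` and
a vertex with first coordinate `b`. -/
def CrossedHoriz (ω : Config 1) (a b : ℤ) (t : ℕ) : Prop :=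
  ∃ (x y : Fin 1 → ℤ) (s u : ℕ), x 0 = a ∧ y 0 = b ∧
    (ConnectedIn ω (rect a b t) x s y u ∨ ConnectedIn ω (rect a b t) y u x s)

/-- `V_p(w, t) = ℙ_p([0,w] × [0,t] is crossed vertically)`. -/
noncomputable def V (p : ℝ) (w : ℕ) (t : ℕ) : ℝ :=
  (P 1 p {ω | CrossedVert ω 0 w t}).toReal

/-- `H_p(w, t) = ℙ_p([0,w] × [0,t] is crossed from left to right)`. -/
noncomputable def H (p : ℝ) (w : ℕ) (t : ℕ) : ℝ :=
  (P 1 p {ω | CrossedHoriz ω 0 w t}).toReal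

/-- The event that `(o, 0)` is connected, inside the box `B_o = [-w,w] × [0,t]`, to the
boundary `∂B_o = {(x,s) ∈ B_o : s = t or |x| = w}`. -/
def ToBoundary (ω : Config 1) (w : ℕ) (t : ℕ) : Prop :=
  ∃ (y : Fin 1 → ℤ) (s : ℕ), (s = t ∨ |y 0| = w) ∧
    ConnectedIn ω (rect (-(w : ℤ)) w t) 0 0 y s


/-! ### The product structure of the configuration measure -/

/-- Bonds of the one-dimensional lattice. -/
abbrev Bd := ℤ × ℕ × Bool

/-- Right endpoint of a bond. -/
def stp (e : Bool) : ℤ := if e then 1 else -1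

/-- Embedding of the simplified bonds. -/
def iot (b : Bd) : Bond 1 := ((fun _ => b.1, b.2.1), fun _ => b.1 + stp b.2.2)

lemma stp_inj : Function.Injective stp := by
  intro a b h; revert h; cases a <;> cases b <;> simp [stp]

lemma iot_inj : Function.Injective iot := by
  rintro ⟨x, s, e⟩ ⟨y, r, f⟩ h
  simp only [iot, Prod.mk.injEq] at h
  obtain ⟨⟨h1, h2⟩, h3⟩ := h
  have h1' := congrFun h1 0
  have h3' := congrFun h3 0
  subst h1'; subst h2
  have : stp e = stp f := by linarith
  rw [stp_inj this]

/-- Lebesgue measure on the unit interval. -/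
noncomputable abbrev U01 : Measure ℝ := (volume : Measure ℝ).restrict (Set.Ico 0 1)

instance : IsProbabilityMeasure U01 := ⟨by simp [U01]⟩

lemma digit_eq (n : ℕ) (x : ℝ) : digit n x = (Real.digits x 2 n : ℕ) := by
  simp [digit, Real.digits, Fin.ofNat, Int.floor_toNat]

lemma unif_eq (i : ℕ) (x : ℝ) : unif i x = Real.ofDigits (fun k => Real.digits x 2 (Nat.pair i k)) := by
  simp [unif, Real.ofDigits, Real.ofDigitsTerm, digit_eq, div_eq_mul_inv]

/-- The digit sequence. -/
noncomputable def Dg (x : ℝ) : ℕ → Fin 2 := Real.digits x 2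

lemma measurable_Dg : Measurable Dg := by
  refine measurable_pi_lambda _ fun n => ?_
  unfold Dg Real.digits
  have : Measurable (fun k : ℕ => Fin.ofNat 2 k) := measurable_from_nat
  refine this.comp (Nat.measurable_floor.comp ?_)
  fun_prop

/-- A fair coin. -/
noncomputable def coin : Measure (Fin 2) := (2⁻¹ : ℝ≥0∞) • Measure.count

instance : IsProbabilityMeasure coin := ⟨by
  simp [coin, Measure.count_univ]
  exact ENNReal.inv_mul_cancel (by simp) (by simp)⟩

lemma coin_singleton (a : Fin 2) : coin {a} = 2⁻¹ := by
  simp [coin]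

/-- numerator of the dyadic cylinder -/
def kk (ε : ℕ → Fin 2) : ℕ → ℕ
  | 0 => 0
  | n+1 => 2 * kk ε n + (ε n : ℕ)

lemma cyl_eq (ε : ℕ → Fin 2) (N : ℕ) :
    {x : ℝ | x ∈ Ico (0:ℝ) 1 ∧ ∀ i < N, Dg x i = ε i} =
      Ico ((kk ε N : ℝ) / 2 ^ N) (((kk ε N : ℝ) + 1) / 2 ^ N) := by
  induction N with
  | zero => ext x; simp [kk]
  | succ n ih =>
    ext x
    have h1 : x ∈ {x : ℝ | x ∈ Ico (0:ℝ) 1 ∧ ∀ i < n + 1, Dg x i = ε i} ↔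
      x ∈ {x : ℝ | x ∈ Ico (0:ℝ) 1 ∧ ∀ i < n, Dg x i = ε i} ∧ Dg x n = ε n := by
      simp only [mem_ofPred_eq, Nat.lt_succ_iff_lt_or_eq]
      constructor
      · rintro ⟨h, h'⟩
        exact ⟨⟨h, fun i hi => h' i (Or.inl hi)⟩, h' n (Or.inr rfl)⟩
      · rintro ⟨⟨h, h'⟩, h2⟩
        refine ⟨h, fun i hi => ?_⟩
        rcases hi with hi | rfl
        · exact h' i hi
        · exact h2
    rw [h1, ih]
    have hp : (0:ℝ) < 2 ^ n := by positivity
    have hp1 : (0:ℝ) < 2 ^ (n+1) := by positivity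
    simp only [mem_Ico, div_le_iff₀ hp, lt_div_iff₀ hp, div_le_iff₀ hp1, lt_div_iff₀ hp1]
    have hd : (Dg x n = ε n) ↔ ⌊x * 2 ^ (n+1)⌋₊ % 2 = (ε n : ℕ) := by
      rw [Fin.ext_iff]
      simp [Dg, Real.digits, Fin.ofNat]
    rw [hd]
    have e : x * 2 ^ (n+1) = 2 * (x * 2 ^ n) := by ring
    set y := x * 2 ^ n with hy
    rw [e]
    have hε : (ε n : ℕ) < 2 := (ε n).2
    simp only [kk]
    push_cast
    set k := kk ε n
    set c : ℕ := (ε n : ℕ)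
    constructor
    · rintro ⟨⟨h1, h2⟩, h3⟩
      have hy0 : (0:ℝ) ≤ 2 * y := by
        have : (0:ℝ) ≤ k := by positivity
        linarith
      have hf1 := Nat.floor_le hy0
      have hf2 := Nat.lt_floor_add_one (2*y)
      have a1 : 2 * k ≤ ⌊2 * y⌋₊ := Nat.le_floor (by push_cast; linarith)
      have a2 : ⌊2 * y⌋₊ < 2 * k + 2 := (Nat.floor_lt hy0).2 (by push_cast; linarith)
      have a3 : ⌊2 * y⌋₊ = 2 * k + c := by omega
      rw [a3] at hf1 hf2
      push_cast at hf1 hf2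
      exact ⟨hf1, hf2⟩
    · rintro ⟨h1, h2⟩
      have hc : (c:ℝ) ≤ 1 := by exact_mod_cast (by omega : c ≤ 1)
      have hc0 : (0:ℝ) ≤ c := by positivity
      refine ⟨⟨by linarith, by linarith⟩, ?_⟩
      have : ⌊2 * y⌋₊ = 2 * k + c := by
        rw [Nat.floor_eq_iff (by have : (0:ℝ) ≤ k := by positivity
                                 linarith)]
        push_cast; exact ⟨h1, h2⟩
      rw [this]; omega

lemma map_Dg : U01.map Dg = Measure.infinitePi (fun _ : ℕ => coin) := by
  refine Measure.eq_infinitePi _ fun s t ht => ?_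
  obtain ⟨N, hN⟩ : ∃ N, s ⊆ Finset.range N := Finset.exists_nat_subset_range s
  let R : (ℕ → Fin 2) → (Fin N → Fin 2) := fun ω i => ω i
  have hR : Measurable R := by fun_prop
  have key : (U01.map Dg).map R = (Measure.infinitePi (fun _ : ℕ => coin)).map R := by
    refine Measure.ext_of_singleton fun ε => ?_
    rw [Measure.map_apply hR (measurableSet_singleton _), Measure.map_apply hR (measurableSet_singleton _),
      Measure.map_apply measurable_Dg (hR (measurableSet_singleton _))]
    let ε' : ℕ → Fin 2 := fun i => if h : i < N then ε ⟨i, h⟩ else 0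
    have e1 : R ⁻¹' {ε} = Set.pi (Finset.range N : Set ℕ) (fun i => {ε' i}) := by
      ext ω
      simp only [mem_preimage, mem_singleton_iff, Set.mem_pi, Finset.coe_range, mem_Iio, R, ε']
      constructor
      · rintro rfl i hi
        simp [hi]
      · intro h
        funext i
        simpa using h i i.2
    have e2 : U01 (Dg ⁻¹' (R ⁻¹' {ε})) = volume {x : ℝ | x ∈ Ico (0:ℝ) 1 ∧ ∀ i < N, Dg x i = ε' i} := by
      rw [Measure.restrict_apply (measurable_Dg (hR (measurableSet_singleton _))), e1]
      congr 1
      ext x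
      simp [Set.mem_pi, and_comm]
    rw [e2, cyl_eq, Real.volume_Ico, e1, Measure.infinitePi_pi _ (fun i _ => measurableSet_singleton _)]
    simp only [coin_singleton, Finset.prod_const, Finset.card_range]
    have : ((kk ε' N : ℝ) + 1) / 2 ^ N - (kk ε' N : ℝ) / 2 ^ N = (2⁻¹) ^ N := by
      rw [← sub_div, inv_pow]; simp
    rw [this, ENNReal.ofReal_pow (by norm_num), ENNReal.ofReal_inv_of_pos (by norm_num)]
    simp
  have hbox : Set.pi (s : Set ℕ) t = R ⁻¹' {g | ∀ i : Fin N, (i : ℕ) ∈ s → g i ∈ t i} := by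
    ext ω
    simp only [Set.mem_pi, Finset.mem_coe, mem_preimage, mem_ofPred_eq, R]
    constructor
    · intro h i hi; exact h i hi
    · intro h i hi
      exact h ⟨i, by simpa using hN hi⟩ hi
  have hm : MeasurableSet {g : Fin N → Fin 2 | ∀ i : Fin N, (i : ℕ) ∈ s → g i ∈ t i} := Set.Finite.measurableSet (Set.toFinite _)
  rw [← Measure.infinitePi_pi (fun _ : ℕ => coin) (fun i _ => ht i), hbox, ← Measure.map_apply hR hm, key, Measure.map_apply hR hm]

lemma measurable_ofDigits : Measurable (Real.ofDigits : (ℕ → Fin 2) → ℝ) :=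
  Real.continuous_ofDigits.measurable

lemma map_ofDigits : (Measure.infinitePi (fun _ : ℕ => coin)).map (Real.ofDigits : (ℕ → Fin 2) → ℝ) = U01 := by
  rw [← map_Dg, Measure.map_map measurable_ofDigits measurable_Dg]
  have : (Real.ofDigits ∘ Dg) =ᵐ[U01] id := by
    filter_upwards [ae_restrict_mem measurableSet_Ico] with x hx
    exact Real.ofDigits_digits (by norm_num) hx
  rw [Measure.map_congr this, Measure.map_id]

/-- Bernoulli measure -/
noncomputable def bern (q : ℝ) : Measure Bool := U01.map (fun x => if x < q then true else false)

lemma meas_lt (q : ℝ) : Measurable (fun x : ℝ => if x < q then true else false) :=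
  Measurable.ite measurableSet_Iio measurable_const measurable_const

instance (q : ℝ) : IsProbabilityMeasure (bern q) :=
  Measure.isProbabilityMeasure_map (meas_lt q).aemeasurable

lemma bern_true {q : ℝ} (hq : q ∈ Icc (0:ℝ) 1) : (bern q).real {true} = q := by
  unfold bern
  rw [measureReal_def, Measure.map_apply (meas_lt q) (measurableSet_singleton _)]
  have : (fun x : ℝ => if x < q then true else false) ⁻¹' {true} = Iio q := by
    ext x; simp
  rw [this, Measure.restrict_apply measurableSet_Iio]
  have : Iio q ∩ Ico 0 1 = Ico (0:ℝ) q := by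
    ext x; simp only [mem_inter_iff, mem_Iio, mem_Ico]
    constructor
    · rintro ⟨a, b, c⟩; exact ⟨b, a⟩
    · rintro ⟨a, b⟩; exact ⟨b, a, lt_of_lt_of_le b hq.2⟩
  rw [this, Real.volume_Ico]; simp [hq.1]

/-- simplified configurations -/
abbrev Om := Bd → Bool

/-- The Bernoulli product measure on simplified configurations. -/
noncomputable def nu (q : ℝ) : Measure Om := Measure.infinitePi (fun _ : Bd => bern q)

instance (q : ℝ) : IsProbabilityMeasure (nu q) := by unfold nu; infer_instance

lemma enc_inj (d : ℕ) : Function.Injective (enc d) := (exists_injective_nat (Bond d)).choose_spec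

lemma measurable_unif (i : ℕ) : Measurable (unif i) := by
  have : unif i = Real.ofDigits ∘ (fun ω : ℕ → Fin 2 => fun k => ω (Nat.pair i k)) ∘ Dg := by
    funext x; exact unif_eq i x
  rw [this]
  refine measurable_ofDigits.comp (Measurable.comp ?_ measurable_Dg)
  fun_prop

lemma measurable_config (d : ℕ) (q : ℝ) : Measurable (config d q) := by
  refine measurable_pi_lambda _ fun b => ?_
  exact (meas_lt q).comp (measurable_unif _)

lemma map_unif : U01.map (fun x i => unif i x) = Measure.infinitePi (fun _ : ℕ => U01) := by
  let Q : (ℕ → Fin 2) → (ℕ → ℕ → Fin 2) := fun ω i k => ω (Nat.pair i k)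
  have hQm : Measurable Q := by fun_prop
  have hQ : (Measure.infinitePi (fun _ : ℕ => coin)).map Q =
      Measure.infinitePi (fun _ : ℕ => Measure.infinitePi (fun _ : ℕ => coin)) := by
    have h1 := Measure.infinitePi_map_curry_symm (ι := ℕ) (κ := ℕ) (X := Fin 2) (fun _ _ => coin)
    have h2 := Measure.infinitePi_map_piCongrLeft (fun _ : ℕ × ℕ => coin) (Nat.pairEquiv.symm)
    have hQe : Q = (MeasurableEquiv.curry ℕ ℕ (Fin 2)) ∘ (MeasurableEquiv.piCongrLeft (fun _ => Fin 2) Nat.pairEquiv.symm) := by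
      funext ω i k
      simp [Q, MeasurableEquiv.piCongrLeft, Equiv.piCongrLeft]
    rw [hQe, ← Measure.map_map (by fun_prop) (by fun_prop), h2, ← h1, Measure.map_map (by fun_prop) (by fun_prop)]
    simp
  have e : (fun x i => unif i x) = (fun (g : ℕ → ℕ → Fin 2) i => Real.ofDigits (g i)) ∘ Q ∘ Dg := by
    funext x i; exact unif_eq i x
  rw [e, ← Measure.map_map, ← Measure.map_map hQm measurable_Dg, map_Dg, hQ,
    Measure.infinitePi_map_pi _ (fun i => measurable_ofDigits)]
  · simp_rw [map_ofDigits]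
  · refine measurable_pi_lambda _ fun i => measurable_ofDigits.comp (measurable_pi_apply i)
  · exact hQm.comp measurable_Dg

lemma map_config (q : ℝ) : (P 1 q).map (fun ω b => ω (iot b)) = nu q := by
  unfold P
  rw [Measure.map_map (by fun_prop) (measurable_config 1 q)]
  have hinj : Function.Injective (fun b => enc 1 (iot b)) := (enc_inj 1).comp iot_inj
  have hi : ProbabilityTheory.iIndepFun (fun i x => unif i x) U01 := by
    rw [ProbabilityTheory.iIndepFun_iff_map_fun_eq_infinitePi_map]
    · rw [map_unif]
      congr 1; funext i
      have := congrArg (fun m => m.map (fun f : ℕ → ℝ => f i)) map_unif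
      rw [Measure.infinitePi_map_eval, Measure.map_map (by fun_prop)] at this
      · exact this.symm
      · exact measurable_pi_lambda _ measurable_unif
    · exact fun i => (measurable_unif i)
  have h2 := (hi.precomp hinj).comp (fun _ x => if x < q then true else false) (fun _ => meas_lt q)
  have h3 := h2.map_fun_eq_infinitePi_map (fun b => ((meas_lt q).comp (measurable_unif _)))
  have e : (fun (ω : Config 1) b => ω (iot b)) ∘ config 1 q = fun x b => ((fun x : ℝ => if x < q then true else false) ∘ (fun i x => unif i x) (enc 1 (iot b))) x := by
    funext x b; rfl
  rw [e]
  refine h3.trans ?_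
  unfold nu
  congr 1; funext b
  rw [← Measure.map_map (meas_lt q) (measurable_unif _)]
  have := congrArg (fun m => m.map (fun f : ℕ → ℝ => f (enc 1 (iot b)))) map_unif
  rw [Measure.infinitePi_map_eval, Measure.map_map (by fun_prop)] at this
  · exact congrArg (Measure.map _) this
  · exact measurable_pi_lambda _ measurable_unif



/-! ### Finite-dependence toolkit -/

/-- Probability of an event. -/
noncomputable def Pr (q : ℝ) (A : Set Om) : ℝ := (nu q).real A

/-- `A` depends only on the bonds in `F`. -/
def Dep (F : Set Bd) (A : Set Om) : Prop :=
  ∀ ω ω' : Om, (∀ b ∈ F, ω b = ω' b) → ω ∈ A → ω' ∈ A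

/-- `A` depends on finitely many bonds. -/
def FinDep (A : Set Om) : Prop := ∃ F : Finset Bd, Dep (F : Set Bd) A

/-- Increasing event. -/
def Inc (A : Set Om) : Prop := ∀ ω ω' : Om, (∀ b, ω b = true → ω' b = true) → ω ∈ A → ω' ∈ A

lemma Dep.mono {F G : Set Bd} {A : Set Om} (h : Dep F A) (hFG : F ⊆ G) : Dep G A :=
  fun ω ω' hω => h ω ω' fun b hb => hω b (hFG hb)

lemma Dep.inter {F : Set Bd} {A B : Set Om} (hA : Dep F A) (hB : Dep F B) : Dep F (A ∩ B) :=
  fun ω ω' h hh => ⟨hA ω ω' h hh.1, hB ω ω' h hh.2⟩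

lemma Dep.union {F : Set Bd} {A B : Set Om} (hA : Dep F A) (hB : Dep F B) : Dep F (A ∪ B) :=
  fun ω ω' h hh => hh.imp (hA ω ω' h) (hB ω ω' h)

lemma Dep.compl {F : Set Bd} {A : Set Om} (hA : Dep F A) : Dep F Aᶜ :=
  fun ω ω' h hh hn => hh (hA ω' ω (fun b hb => (h b hb).symm) hn)

lemma FinDep.inter {A B : Set Om} (hA : FinDep A) (hB : FinDep B) : FinDep (A ∩ B) := by
  obtain ⟨F, hF⟩ := hA
  obtain ⟨G, hG⟩ := hB
  exact ⟨F ∪ G, (hF.mono (by simp)).inter (hG.mono (by simp))⟩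

lemma FinDep.union {A B : Set Om} (hA : FinDep A) (hB : FinDep B) : FinDep (A ∪ B) := by
  obtain ⟨F, hF⟩ := hA
  obtain ⟨G, hG⟩ := hB
  exact ⟨F ∪ G, (hF.mono (by simp)).union (hG.mono (by simp))⟩

lemma FinDep.compl {A : Set Om} (hA : FinDep A) : FinDep Aᶜ := by
  obtain ⟨F, hF⟩ := hA
  exact ⟨F, hF.compl⟩

lemma FinDep.diff {A B : Set Om} (hA : FinDep A) (hB : FinDep B) : FinDep (A \ B) :=
  hA.inter hB.compl

lemma Inc.inter {A B : Set Om} (hA : Inc A) (hB : Inc B) : Inc (A ∩ B) :=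
  fun ω ω' h hh => ⟨hA ω ω' h hh.1, hB ω ω' h hh.2⟩

/-- extension by false -/
noncomputable def extF (F : Finset Bd) (g : F → Bool) : Om := fun b => if h : b ∈ F then g ⟨b, h⟩ else false

lemma Dep.eq_preimage {F : Finset Bd} {A : Set Om} (h : Dep (F : Set Bd) A) :
    A = (fun (ω : Om) (b : F) => ω b) ⁻¹' {g | extF F g ∈ A} := by
  ext ω
  constructor
  · intro hω
    refine h ω _ (fun b hb => ?_) hω
    simp only [Finset.mem_coe] at hb
    simp [extF, hb]
  · intro hω
    refine h _ ω (fun b hb => ?_) hω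
    simp only [Finset.mem_coe] at hb
    simp [extF, hb]

lemma FinDep.meas {A : Set Om} (hA : FinDep A) : MeasurableSet A := by
  obtain ⟨F, hF⟩ := hA
  rw [hF.eq_preimage]
  have : Measurable (fun (ω : Om) (b : F) => ω b) := by fun_prop
  exact this (Set.Finite.measurableSet (Set.toFinite _))

/-- slice -/
def slice (b : Bd) (c : Bool) (A : Set Om) : Set Om := {ω | Function.update ω b c ∈ A}

lemma Dep.slice {F : Finset Bd} {A : Set Om} (h : Dep (F : Set Bd) A) (b : Bd) (c : Bool) :
    Dep ((F.erase b : Finset Bd) : Set Bd) (slice b c A) := by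
  intro ω ω' hω
  refine h _ _ fun b' hb' => ?_
  by_cases e : b' = b
  · subst e; simp
  · simp only [Function.update_of_ne e]
    exact hω b' (by simp at hb' ⊢; exact ⟨hb', e⟩)

lemma pr_inter_coord (q : ℝ) (b : Bd) (c : Bool) {F : Finset Bd} (hb : b ∉ F) {A : Set Om}
    (h : Dep (F : Set Bd) A) : (nu q).real ({ω | ω b = c} ∩ A) = (bern q).real {c} * (nu q).real A := by
  have hi : ProbabilityTheory.iIndepFun (fun (b : Bd) (ω : Om) => ω b) (nu q) :=
    ProbabilityTheory.iIndepFun_infinitePi (P := fun _ : Bd => bern q) (X := fun _ x => x) (fun _ => measurable_id)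
  have hd := hi.indepFun_finset {b} F (by simpa using hb) (fun b => measurable_pi_apply b)
  have e1 : {ω : Om | ω b = c} = (fun (ω : Om) (i : ({b} : Finset Bd)) => ω i) ⁻¹' {g | g ⟨b, by simp⟩ = c} := by
    ext ω; simp
  have := hd.measure_inter_preimage_eq_mul {g | g ⟨b, by simp⟩ = c} {g | extF F g ∈ A}
    (Set.Finite.measurableSet (Set.toFinite _)) (Set.Finite.measurableSet (Set.toFinite _))
  rw [← e1, ← h.eq_preimage] at this
  have e2 : nu q {ω : Om | ω b = c} = bern q {c} := by
    have h3 : (nu q).map (fun ω : Om => ω b) = bern q := Measure.infinitePi_map_eval (fun _ : Bd => bern q) b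
    rw [← h3, Measure.map_apply (measurable_pi_apply b) (measurableSet_singleton _)]
    rfl
  simp only [measureReal_def]
  rw [this, e2, ENNReal.toReal_mul]

lemma bern_false {q : ℝ} (hq : q ∈ Icc (0:ℝ) 1) : (bern q).real {false} = 1 - q := by
  have : ({false} : Set Bool) = {true}ᶜ := by ext x; cases x <;> simp
  rw [this, measureReal_compl (measurableSet_singleton _), bern_true hq, probReal_univ]

lemma pr_split {q : ℝ} (hq : q ∈ Icc (0:ℝ) 1) (b : Bd) {F : Finset Bd} {A : Set Om} (h : Dep (F : Set Bd) A) :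
    Pr q A = q * Pr q (slice b true A) + (1 - q) * Pr q (slice b false A) := by
  unfold Pr
  have hm : MeasurableSet {ω : Om | ω b = true} := (measurable_pi_apply b : Measurable (fun ω : Om => ω b)) (measurableSet_singleton true)
  rw [← measureReal_inter_add_sdiff (s := A) hm]
  have e1 : A ∩ {ω : Om | ω b = true} = {ω | ω b = true} ∩ slice b true A := by
    ext ω; simp only [mem_inter_iff, mem_ofPred_eq, slice]
    constructor
    · rintro ⟨h1, h2⟩; refine ⟨h2, ?_⟩; rw [← h2, Function.update_eq_self]; exact h1
    · rintro ⟨h1, h2⟩; refine ⟨?_, h1⟩; rwa [← h1, Function.update_eq_self] at h2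
  have e2 : A \ {ω : Om | ω b = true} = {ω | ω b = false} ∩ slice b false A := by
    ext ω; simp only [mem_inter_iff, Set.mem_sdiff, mem_ofPred_eq, slice, Bool.not_eq_true]
    constructor
    · rintro ⟨h1, h2⟩; refine ⟨h2, ?_⟩; rw [← h2, Function.update_eq_self]; exact h1
    · rintro ⟨h1, h2⟩; refine ⟨?_, h1⟩; rwa [← h1, Function.update_eq_self] at h2
  rw [e1, e2, pr_inter_coord q b true (Finset.notMem_erase b F) (h.slice b true),
    pr_inter_coord q b false (Finset.notMem_erase b F) (h.slice b false), bern_true hq, bern_false hq]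

lemma pr_nonneg (q : ℝ) (A : Set Om) : 0 ≤ Pr q A := measureReal_nonneg
lemma pr_le_one (q : ℝ) (A : Set Om) : Pr q A ≤ 1 := measureReal_le_one
lemma pr_mono {q : ℝ} {A B : Set Om} (h : A ⊆ B) : Pr q A ≤ Pr q B := measureReal_mono h
lemma pr_empty (q : ℝ) : Pr q ∅ = 0 := measureReal_empty
lemma pr_univ (q : ℝ) : Pr q univ = 1 := by simp [Pr]
lemma pr_union_le (q : ℝ) (A B : Set Om) : Pr q (A ∪ B) ≤ Pr q A + Pr q B := measureReal_union_le A B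

lemma dep_empty {A : Set Om} (h : Dep ((∅ : Finset Bd) : Set Bd) A) : A = ∅ ∨ A = univ := by
  rcases A.eq_empty_or_nonempty with h' | ⟨ω, hω⟩
  · exact Or.inl h'
  · right; ext ω'; simp only [mem_univ, iff_true]; exact h ω ω' (by simp) hω

/-- monotone in one bond -/
def MonoB (b : Bd) (A : Set Om) : Prop := slice b false A ⊆ slice b true A
/-- independent of one bond -/
def IndB (b : Bd) (A : Set Om) : Prop := slice b false A = slice b true A

lemma slice_comm {b b' : Bd} (hne : b ≠ b') (c c' : Bool) (A : Set Om) :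
    slice b c (slice b' c' A) = slice b' c' (slice b c A) := by
  ext ω; simp only [slice, mem_ofPred_eq]
  rw [Function.update_comm hne]

lemma slice_mono (b : Bd) (c : Bool) {A B : Set Om} (h : A ⊆ B) : slice b c A ⊆ slice b c B :=
  fun _ hω => h hω

lemma slice_inter (b : Bd) (c : Bool) (A B : Set Om) : slice b c (A ∩ B) = slice b c A ∩ slice b c B := rfl

lemma MonoB.slice {b b' : Bd} (hne : b ≠ b') (c : Bool) {A : Set Om} (h : MonoB b A) : MonoB b (slice b' c A) := by
  unfold MonoB at *
  rw [slice_comm hne, slice_comm hne]; exact slice_mono _ _ h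

lemma IndB.slice {b b' : Bd} (hne : b ≠ b') (c : Bool) {A : Set Om} (h : IndB b A) : IndB b (slice b' c A) := by
  unfold IndB at *
  rw [slice_comm hne, slice_comm hne, h]

lemma fkg_aux {q : ℝ} (hq : q ∈ Icc (0:ℝ) 1) (F : Finset Bd) : ∀ A B : Set Om,
    Dep (F : Set Bd) A → Dep (F : Set Bd) B →
    (∀ b ∈ F, (MonoB b A ∧ MonoB b B) ∨ IndB b A ∨ IndB b B) → Pr q A * Pr q B ≤ Pr q (A ∩ B) := by
  induction F using Finset.induction_on with
  | empty =>
    intro A B hA hB _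
    rcases dep_empty hA with rfl | rfl
    · simp [pr_empty]
    · simp [pr_univ]
  | insert b F hb ih =>
    intro A B hA hB hc
    have er : (insert b F).erase b = F := Finset.erase_insert hb
    have hs : ∀ c, Pr q (slice b c A) * Pr q (slice b c B) ≤ Pr q (slice b c (A ∩ B)) := by
      intro c
      rw [slice_inter]
      refine ih _ _ (er ▸ hA.slice b c) (er ▸ hB.slice b c) fun b' hb' => ?_
      have hne : b' ≠ b := fun e => hb (e ▸ hb')
      rcases hc b' (Finset.mem_insert_of_mem hb') with ⟨h1, h2⟩ | h1 | h1
      · exact Or.inl ⟨h1.slice hne c, h2.slice hne c⟩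
      · exact Or.inr (Or.inl (h1.slice hne c))
      · exact Or.inr (Or.inr (h1.slice hne c))
    rw [pr_split hq b hA, pr_split hq b hB, pr_split hq b (hA.inter hB)]
    have h1 := hs true
    have h0 := hs false
    have hq0 := hq.1
    have hq1 : 0 ≤ 1 - q := by linarith [hq.2]
    have hk : 0 ≤ (Pr q (slice b true A) - Pr q (slice b false A)) * (Pr q (slice b true B) - Pr q (slice b false B)) := by
      rcases hc b (Finset.mem_insert_self b F) with ⟨h1, h2⟩ | h1 | h1
      · exact mul_nonneg (sub_nonneg.2 (pr_mono h1)) (sub_nonneg.2 (pr_mono h2))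
      · rw [show slice b false A = slice b true A from h1]; simp
      · rw [show slice b false B = slice b true B from h1]; simp
    have m1 := mul_le_mul_of_nonneg_left h1 hq0
    have m0 := mul_le_mul_of_nonneg_left h0 hq1
    have m2 := mul_nonneg (mul_nonneg hq0 hq1) hk
    linarith

lemma Inc.monoB {A : Set Om} (h : Inc A) (b : Bd) : MonoB b A := by
  intro ω hω
  refine h _ _ (fun b' hb' => ?_) hω
  by_cases e : b' = b
  · subst e; simp
  · rwa [Function.update_of_ne e] at hb' ⊢

lemma Dep.indB {G : Set Bd} {A : Set Om} (h : Dep G A) {b : Bd} (hb : b ∉ G) : IndB b A := by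
  ext ω
  have : ∀ c c' : Bool, ∀ b' ∈ G, Function.update ω b c b' = Function.update ω b c' b' := by
    intro c c' b' hb'
    have e : b' ≠ b := fun e => hb (e ▸ hb')
    simp [Function.update_of_ne e]
  exact ⟨h _ _ (this _ _), h _ _ (this _ _)⟩

lemma IndB.inter {b : Bd} {A B : Set Om} (hA : IndB b A) (hB : IndB b B) : IndB b (A ∩ B) := by
  unfold IndB at *; rw [slice_inter, slice_inter, hA, hB]

lemma MonoB.inter {b : Bd} {A B : Set Om} (hA : MonoB b A) (hB : MonoB b B) : MonoB b (A ∩ B) :=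
  fun _ h => ⟨hA h.1, hB h.2⟩

lemma IndB.monoB {b : Bd} {A : Set Om} (hA : IndB b A) : MonoB b A := hA.subset

lemma fkg {q : ℝ} (hq : q ∈ Icc (0:ℝ) 1) {A B : Set Om} (fA : FinDep A) (fB : FinDep B) (iA : Inc A) (iB : Inc B) :
    Pr q A * Pr q B ≤ Pr q (A ∩ B) := by
  obtain ⟨F, hF⟩ := fA
  obtain ⟨G, hG⟩ := fB
  exact fkg_aux hq (F ∪ G) A B (hF.mono (by simp)) (hG.mono (by simp)) fun b _ => Or.inl ⟨iA.monoB b, iB.monoB b⟩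

lemma cfkg {q : ℝ} (hq : q ∈ Icc (0:ℝ) 1) {A S K : Set Om} (G : Set Bd) (fA : FinDep A) (fS : FinDep S) (fK : FinDep K)
    (iS : Inc S) (iK : Inc K) (dA : Dep G A) (dK : Dep Gᶜ K) :
    Pr q (A ∩ S) * Pr q K ≤ Pr q (A ∩ S ∩ K) := by
  obtain ⟨F, hF⟩ := fA.inter fS
  obtain ⟨G', hG'⟩ := fK
  refine fkg_aux hq (F ∪ G') _ _ (hF.mono (by simp)) (hG'.mono (by simp)) fun b _ => ?_
  by_cases hb : b ∈ G
  · exact Or.inr (Or.inr (dK.indB (by simpa using hb)))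
  · exact Or.inl ⟨(dA.indB hb).monoB.inter (iS.monoB b), iK.monoB b⟩

lemma indep_ge {q : ℝ} (hq : q ∈ Icc (0:ℝ) 1) {A B : Set Om} (G : Set Bd) (fA : FinDep A) (fB : FinDep B)
    (dA : Dep G A) (dB : Dep Gᶜ B) : Pr q A * Pr q B ≤ Pr q (A ∩ B) := by
  obtain ⟨F, hF⟩ := fA
  obtain ⟨G', hG'⟩ := fB
  refine fkg_aux hq (F ∪ G') _ _ (hF.mono (by simp)) (hG'.mono (by simp)) fun b _ => ?_
  by_cases hb : b ∈ G
  · exact Or.inr (Or.inr (dB.indB (by simpa using hb)))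
  · exact Or.inr (Or.inl (dA.indB hb))

lemma pr_compl {q : ℝ} {A : Set Om} (fA : FinDep A) : Pr q Aᶜ = 1 - Pr q A := by
  unfold Pr; rw [measureReal_compl fA.meas]; simp

lemma pr_inter_add {q : ℝ} {A : Set Om} {B : Set Om} (fB : FinDep B) : Pr q (A ∩ B) + Pr q (A ∩ Bᶜ) = Pr q A := by
  unfold Pr; exact measureReal_inter_add_sdiff fB.meas

lemma indep {q : ℝ} (hq : q ∈ Icc (0:ℝ) 1) {A B : Set Om} (G : Set Bd) (fA : FinDep A) (fB : FinDep B)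
    (dA : Dep G A) (dB : Dep Gᶜ B) : Pr q (A ∩ B) = Pr q A * Pr q B := by
  refine le_antisymm ?_ (indep_ge hq G fA fB dA dB)
  have h1 := indep_ge hq G fA fB.compl dA dB.compl
  have h2 := pr_inter_add (q := q) (A := A) fB
  rw [pr_compl fB] at h1
  linarith

lemma pr_inv (q : ℝ) {φ : Bd → Bd} (hφ : Function.Injective φ) {A : Set Om} (fA : FinDep A) :
    Pr q {ω | (fun b => ω (φ b)) ∈ A} = Pr q A := by
  have h : (nu q).map (fun (ω : Om) b => ω (φ b)) = nu q :=
    Measure.map_infinitePi_infinitePi_of_inj (P := fun _ : Bd => bern q) hφ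
  unfold Pr
  have hm : Measurable (fun (ω : Om) b => ω (φ b)) := by fun_prop
  conv_rhs => rw [← h]
  rw [measureReal_def, measureReal_def, Measure.map_apply hm fA.meas]
  rfl

lemma pr_cont_aux (F : Finset Bd) : ∀ A : Set Om, Dep (F : Set Bd) A → ContinuousOn (fun q => Pr q A) (Icc 0 1) := by
  induction F using Finset.induction_on with
  | empty =>
    intro A hA
    rcases dep_empty hA with rfl | rfl
    · simp only [pr_empty]; exact continuousOn_const
    · simp only [pr_univ]; exact continuousOn_const
  | insert b F hb ih =>
    intro A hA
    have er : (insert b F).erase b = F := Finset.erase_insert hb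
    have c1 := ih _ (er ▸ hA.slice b true)
    have c0 := ih _ (er ▸ hA.slice b false)
    have : ContinuousOn (fun q => q * Pr q (slice b true A) + (1 - q) * Pr q (slice b false A)) (Icc 0 1) := by
      fun_prop
    exact this.congr fun q hq => pr_split hq b hA

lemma pr_cont {A : Set Om} (fA : FinDep A) : ContinuousOn (fun q => Pr q A) (Icc 0 1) := by
  obtain ⟨F, hF⟩ := fA
  exact pr_cont_aux F A hF

lemma pr_one_aux (F : Finset Bd) : ∀ A : Set Om, Dep (F : Set Bd) A → (fun _ => true) ∈ A → Pr 1 A = 1 := by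
  induction F using Finset.induction_on with
  | empty =>
    intro A hA hm
    rcases dep_empty hA with rfl | rfl
    · exact absurd hm (by simp)
    · exact pr_univ 1
  | insert b F hb ih =>
    intro A hA hm
    have er : (insert b F).erase b = F := Finset.erase_insert hb
    rw [pr_split (by simp) b hA, ih _ (er ▸ hA.slice b true)]
    · simp
    · have : Function.update (fun _ : Bd => true) b true = fun _ => true := by
        funext b'; simp [Function.update_apply]
      simp only [slice, mem_ofPred_eq]; rw [this]; exact hm

lemma pr_one {A : Set Om} (fA : FinDep A) (h : (fun _ => true) ∈ A) : Pr 1 A = 1 := by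
  obtain ⟨F, hF⟩ := fA
  exact pr_one_aux F A hF h

lemma pr_sum_disj {q : ℝ} {ι : Type*} (s : Finset ι) (A : ι → Set Om) (fA : ∀ i ∈ s, FinDep (A i))
    (hd : ∀ i ∈ s, ∀ j ∈ s, i ≠ j → Disjoint (A i) (A j)) :
    Pr q (⋃ i ∈ s, A i) = ∑ i ∈ s, Pr q (A i) := by
  unfold Pr
  exact measureReal_biUnion_finset (fun i hi j hj hij => hd i hi j hj hij) (fun i hi => (fA i hi).meas)



/-! ### Paths -/

/-- open path on the time interval `[s, r]` -/
def Pth (ω : Om) (v : ℕ → ℤ) (s r : ℕ) : Prop :=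
  ∀ j, s ≤ j → j < r → ∃ e, v (j + 1) = v j + stp e ∧ ω (v j, j, e) = true

/-- open connection -/
def Conn (ω : Om) (x : ℤ) (s : ℕ) (y : ℤ) (t : ℕ) : Prop :=
  s ≤ t ∧ ∃ v : ℕ → ℤ, v s = x ∧ v t = y ∧ Pth ω v s t

lemma stp_cases (e : Bool) : stp e = 1 ∨ stp e = -1 := by cases e <;> simp [stp]

lemma Pth.mono {ω : Om} {v : ℕ → ℤ} {s r s' r' : ℕ} (h : Pth ω v s r) (hs : s ≤ s') (hr : r' ≤ r) :
    Pth ω v s' r' := fun j h1 h2 => h j (by omega) (by omega)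

lemma Pth.bound {ω : Om} {v : ℕ → ℤ} {s r : ℕ} (h : Pth ω v s r) {i j : ℕ} (hi : s ≤ i) (hij : i ≤ j) (hj : j ≤ r) :
    |v j - v i| ≤ (j : ℤ) - i ∧ 2 ∣ v j - v i - ((j : ℤ) - i) := by
  induction j, hij using Nat.le_induction with
  | base => simp
  | succ j hij ih =>
    obtain ⟨h1, h2⟩ := ih (by omega)
    obtain ⟨e, he, -⟩ := h j (by omega) (by omega)
    rw [abs_le] at *
    push_cast
    rcases stp_cases e with h' | h' <;> rw [h'] at he <;> omega

lemma Conn.bound {ω : Om} {x y : ℤ} {s t : ℕ} (h : Conn ω x s y t) :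
    |y - x| ≤ (t : ℤ) - s ∧ 2 ∣ y - x - ((t : ℤ) - s) := by
  obtain ⟨hst, v, rfl, rfl, hp⟩ := h
  exact hp.bound le_rfl hst le_rfl

lemma Conn.le {ω : Om} {x y : ℤ} {s t : ℕ} (h : Conn ω x s y t) : s ≤ t := h.1

lemma Conn.refl (ω : Om) (x : ℤ) (s : ℕ) : Conn ω x s x s :=
  ⟨le_rfl, fun _ => x, rfl, rfl, fun j h1 h2 => by omega⟩

lemma Pth.concat {ω : Om} {v w : ℕ → ℤ} {s j r : ℕ} (hv : Pth ω v s j) (hw : Pth ω w j r) (h : v j = w j) :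
    Pth ω (fun i => if i ≤ j then v i else w i) s r := by
  intro i h1 h2
  rcases lt_trichotomy i j with hij | rfl | hij
  · obtain ⟨e, he, ho⟩ := hv i h1 hij
    refine ⟨e, ?_⟩
    simp only [if_pos hij.le, if_pos (show i + 1 ≤ j by omega)]
    exact ⟨he, ho⟩
  · obtain ⟨e, he, ho⟩ := hw i le_rfl h2
    refine ⟨e, ?_⟩
    simp only [le_refl, if_true, if_neg (show ¬ i + 1 ≤ i by omega), h]
    exact ⟨he, ho⟩
  · obtain ⟨e, he, ho⟩ := hw i hij.le h2
    refine ⟨e, ?_⟩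
    simp only [if_neg (show ¬ i ≤ j by omega), if_neg (show ¬ i + 1 ≤ j by omega)]
    exact ⟨he, ho⟩

lemma Conn.trans {ω : Om} {x y z : ℤ} {s t r : ℕ} (h : Conn ω x s y t) (h' : Conn ω y t z r) : Conn ω x s z r := by
  obtain ⟨hst, v, rfl, rfl, hv⟩ := h
  obtain ⟨htr, w, hw1, rfl, hw⟩ := h'
  refine ⟨hst.trans htr, _, ?_, ?_, hv.concat hw hw1.symm⟩
  · simp [hst]
  · by_cases e : r ≤ t
    · have : r = t := le_antisymm e htr
      subst this; simp [hw1]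
    · simp [e]

lemma Pth.conn {ω : Om} {v : ℕ → ℤ} {s r : ℕ} (h : Pth ω v s r) {i j : ℕ} (hi : s ≤ i) (hij : i ≤ j) (hj : j ≤ r) :
    Conn ω (v i) i (v j) j := ⟨hij, v, rfl, rfl, h.mono hi hj⟩

lemma Conn.split {ω : Om} {x y : ℤ} {s t : ℕ} (h : Conn ω x s y t) {r : ℕ} (h1 : s ≤ r) (h2 : r ≤ t) :
    ∃ w, Conn ω x s w r ∧ Conn ω w r y t := by
  obtain ⟨hst, v, rfl, rfl, hv⟩ := h
  exact ⟨v r, hv.conn le_rfl h1 h2, hv.conn h1 h2 le_rfl⟩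

lemma meet {ω : Om} {v w : ℕ → ℤ} {s t : ℕ} (hst : s ≤ t) (hv : Pth ω v s t) (hw : Pth ω w s t)
    (hp : 2 ∣ w s - v s) (h1 : v s ≤ w s) (h2 : w t ≤ v t) : ∃ j, s ≤ j ∧ j ≤ t ∧ v j = w j := by
  by_contra hcon
  push Not at hcon
  have : ∀ j, s ≤ j → j ≤ t → v j < w j := by
    intro j hsj
    induction j, hsj using Nat.le_induction with
    | base => intro h; exact lt_of_le_of_ne h1 (hcon s le_rfl h)
    | succ j hsj ih =>
      intro hj
      have i1 := ih (by omega)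
      have b1 := (hv.bound (i := s) (j := j) le_rfl hsj (by omega)).2
      have b2 := (hw.bound (i := s) (j := j) le_rfl hsj (by omega)).2
      obtain ⟨e, he, -⟩ := hv j hsj (by omega)
      obtain ⟨e', he', -⟩ := hw j hsj (by omega)
      have hne := hcon (j+1) (by omega) hj
      rcases stp_cases e with h | h <;> rcases stp_cases e' with h' | h' <;> rw [h] at he <;> rw [h'] at he' <;> omega
  have := this t hst le_rfl
  omega

lemma Conn.cross {ω : Om} {x y x' y' : ℤ} {s t : ℕ} (h : Conn ω x s y t) (h' : Conn ω x' s y' t)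
    (hp : 2 ∣ x' - x) (h1 : x ≤ x') (h2 : y' ≤ y) : Conn ω x s y' t ∧ Conn ω x' s y t := by
  obtain ⟨hst, v, rfl, rfl, hv⟩ := h
  obtain ⟨-, w, rfl, rfl, hw⟩ := h'
  obtain ⟨j, hj1, hj2, e⟩ := meet hst hv hw hp h1 h2
  constructor
  · exact (hv.conn le_rfl hj1 hj2).trans (e ▸ hw.conn hj1 hj2 le_rfl)
  · exact (hw.conn le_rfl hj1 hj2).trans (e ▸ hv.conn hj1 hj2 le_rfl)

/-- box of bonds -/
def GB (M : ℤ) (S T : ℕ) : Set Bd := {b | |b.1| ≤ M ∧ S ≤ b.2.1 ∧ b.2.1 < T}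

lemma GB_finite (M : ℤ) (S T : ℕ) : (GB M S T).Finite := by
  refine ((Set.finite_Icc (-M) M).prod ((Set.finite_Iio T).prod (Set.finite_univ (α := Bool)))).subset ?_
  rintro ⟨x, s, e⟩ ⟨h1, h2, h3⟩
  simp only at h1 h2 h3
  rw [abs_le] at h1
  simp [h1, h3]

lemma Dep.fin {M : ℤ} {S T : ℕ} {A : Set Om} (h : Dep (GB M S T) A) : FinDep A :=
  ⟨(GB_finite M S T).toFinset, by simpa using h⟩

lemma Pth.transfer {ω ω' : Om} {v : ℕ → ℤ} {s r : ℕ} {G : Set Bd} (h : Pth ω v s r) (hG : ∀ b ∈ G, ω b = ω' b)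
    (hv : ∀ j e, s ≤ j → j < r → v (j+1) = v j + stp e → (v j, j, e) ∈ G) : Pth ω' v s r := by
  intro j h1 h2
  obtain ⟨e, he, ho⟩ := h j h1 h2
  exact ⟨e, he, by rw [← hG _ (hv j e h1 h2 he)]; exact ho⟩

lemma Conn.transfer {ω ω' : Om} {x y : ℤ} {s t : ℕ} {M : ℤ} {S T : ℕ} (h : Conn ω x s y t)
    (hG : ∀ b ∈ GB M S T, ω b = ω' b) (hM : |x| + ((t : ℤ) - s) ≤ M) (hS : S ≤ s) (hT : t ≤ T) : Conn ω' x s y t := by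
  obtain ⟨hst, v, rfl, rfl, hv⟩ := h
  refine ⟨hst, v, rfl, rfl, hv.transfer hG fun j e h1 h2 _ => ⟨?_, by simp; omega, by simp; omega⟩⟩
  have := (hv.bound le_rfl h1 h2.le).1
  simp only
  have h3 := abs_sub_abs_le_abs_sub (v j) (v s)
  omega

lemma Conn.inc {ω ω' : Om} {x y : ℤ} {s t : ℕ} (h : Conn ω x s y t) (hω : ∀ b, ω b = true → ω' b = true) :
    Conn ω' x s y t := by
  obtain ⟨hst, v, h1, h2, hv⟩ := h
  refine ⟨hst, v, h1, h2, fun j a b => ?_⟩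
  obtain ⟨e, he, ho⟩ := hv j a b
  exact ⟨e, he, hω _ ho⟩

/-! ### Events -/

/-- the half line ending at `a` at time `s` reaches beyond `x` at time `t` -/
def HL (a : ℤ) (s : ℕ) (x : ℤ) (t : ℕ) : Set Om :=
  {ω | ∃ z y, z ≤ a ∧ 2 ∣ a - z ∧ x ≤ y ∧ Conn ω z s y t}
/-- the half line hits the column `x` before time `t` -/
def Hit (a : ℤ) (s : ℕ) (x : ℤ) (t : ℕ) : Set Om :=
  {ω | ∃ z r, z ≤ a ∧ 2 ∣ a - z ∧ r ≤ t ∧ Conn ω z s x r}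
/-- the origin hits the column `x` before time `t` -/
def Nh (x : ℤ) (t : ℕ) : Set Om := {ω | ∃ r, r ≤ t ∧ Conn ω 0 0 x r}
/-- the origin reaches beyond `x` at time `t` -/
def Rr (x : ℤ) (t : ℕ) : Set Om := {ω | ∃ y, x ≤ y ∧ Conn ω 0 0 y t}
/-- survival -/
def Th (t : ℕ) : Set Om := {ω | ∃ y, Conn ω 0 0 y t}
/-- two-point event -/
def Ta (x : ℤ) (t : ℕ) : Set Om := {ω | Conn ω 0 0 x t}

lemma HL_dep (a : ℤ) (s : ℕ) (x : ℤ) (t : ℕ) : Dep (GB (|a| + |x| + 2 * t) s t) (HL a s x t) := by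
  rintro ω ω' h ⟨z, y, h1, h2, h3, h4⟩
  refine ⟨z, y, h1, h2, h3, h4.transfer h ?_ le_rfl le_rfl⟩
  have b := h4.bound.1
  rcases abs_cases z with ⟨u, _⟩ | ⟨u, _⟩ <;> rcases abs_cases a with ⟨u2, _⟩ | ⟨u2, _⟩ <;>
    rcases abs_cases x with ⟨u3, _⟩ | ⟨u3, _⟩ <;> rw [abs_le] at b <;> omega

lemma Hit_dep (a : ℤ) (s : ℕ) (x : ℤ) (t : ℕ) : Dep (GB (|a| + |x| + 2 * t) s t) (Hit a s x t) := by
  rintro ω ω' h ⟨z, r, h1, h2, h3, h4⟩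
  refine ⟨z, r, h1, h2, h3, h4.transfer h ?_ le_rfl h3⟩
  have b := h4.bound.1
  rcases abs_cases z with ⟨u, _⟩ | ⟨u, _⟩ <;> rcases abs_cases a with ⟨u2, _⟩ | ⟨u2, _⟩ <;>
    rcases abs_cases x with ⟨u3, _⟩ | ⟨u3, _⟩ <;> rw [abs_le] at b <;> omega

lemma Nh_dep (x : ℤ) (t : ℕ) : Dep (GB t 0 t) (Nh x t) := by
  rintro ω ω' h ⟨r, h1, h2⟩
  exact ⟨r, h1, h2.transfer h (by simp; omega) le_rfl h1⟩

lemma Rr_dep (x : ℤ) (t : ℕ) : Dep (GB t 0 t) (Rr x t) := by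
  rintro ω ω' h ⟨y, h1, h2⟩
  exact ⟨y, h1, h2.transfer h (by simp) le_rfl le_rfl⟩

lemma Th_dep (t : ℕ) : Dep (GB t 0 t) (Th t) := by
  rintro ω ω' h ⟨y, h2⟩
  exact ⟨y, h2.transfer h (by simp) le_rfl le_rfl⟩

lemma Ta_dep (x : ℤ) (t : ℕ) : Dep (GB t 0 t) (Ta x t) := by
  intro ω ω' h h2
  exact Conn.transfer h2 h (by simp) le_rfl le_rfl

lemma HL_inc (a : ℤ) (s : ℕ) (x : ℤ) (t : ℕ) : Inc (HL a s x t) := by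
  rintro ω ω' h ⟨z, y, h1, h2, h3, h4⟩; exact ⟨z, y, h1, h2, h3, h4.inc h⟩
lemma Hit_inc (a : ℤ) (s : ℕ) (x : ℤ) (t : ℕ) : Inc (Hit a s x t) := by
  rintro ω ω' h ⟨z, y, h1, h2, h3, h4⟩; exact ⟨z, y, h1, h2, h3, h4.inc h⟩
lemma Nh_inc (x : ℤ) (t : ℕ) : Inc (Nh x t) := by
  rintro ω ω' h ⟨r, h1, h2⟩; exact ⟨r, h1, h2.inc h⟩
lemma Rr_inc (x : ℤ) (t : ℕ) : Inc (Rr x t) := by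
  rintro ω ω' h ⟨r, h1, h2⟩; exact ⟨r, h1, h2.inc h⟩
lemma Th_inc (t : ℕ) : Inc (Th t) := by
  rintro ω ω' h ⟨r, h2⟩; exact ⟨r, h2.inc h⟩
lemma Ta_inc (x : ℤ) (t : ℕ) : Inc (Ta x t) := by
  intro ω ω' h h2; exact Conn.inc h2 h

lemma HL_fin (a : ℤ) (s : ℕ) (x : ℤ) (t : ℕ) : FinDep (HL a s x t) := (HL_dep a s x t).fin
lemma Hit_fin (a : ℤ) (s : ℕ) (x : ℤ) (t : ℕ) : FinDep (Hit a s x t) := (Hit_dep a s x t).fin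
lemma Nh_fin (x : ℤ) (t : ℕ) : FinDep (Nh x t) := (Nh_dep x t).fin
lemma Rr_fin (x : ℤ) (t : ℕ) : FinDep (Rr x t) := (Rr_dep x t).fin
lemma Th_fin (t : ℕ) : FinDep (Th t) := (Th_dep t).fin
lemma Ta_fin (x : ℤ) (t : ℕ) : FinDep (Ta x t) := (Ta_dep x t).fin

/-! ### Symmetries -/

/-- translation of bonds -/
def shf (a : ℤ) (u : ℕ) (b : Bd) : Bd := (b.1 + a, b.2.1 + u, b.2.2)

lemma shf_inj (a : ℤ) (u : ℕ) : Function.Injective (shf a u) := by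
  rintro ⟨x, s, e⟩ ⟨y, r, f⟩ h
  simp only [shf, Prod.mk.injEq] at h ⊢
  obtain ⟨h1, h2, h3⟩ := h
  exact ⟨by omega, by omega, h3⟩

lemma conn_shf (ω : Om) (a : ℤ) (u : ℕ) (x : ℤ) (s : ℕ) (y : ℤ) (t : ℕ) :
    Conn (fun b => ω (shf a u b)) x s y t ↔ Conn ω (x + a) (s + u) (y + a) (t + u) := by
  constructor
  · rintro ⟨hst, v, rfl, rfl, hv⟩
    refine ⟨by omega, fun j => v (j - u) + a, by simp, by simp, fun j h1 h2 => ?_⟩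
    obtain ⟨e, he, ho⟩ := hv (j - u) (by omega) (by omega)
    refine ⟨e, ?_, ?_⟩
    · have : j + 1 - u = j - u + 1 := by omega
      simp only [this, he]; ring
    · simp only [shf] at ho
      rwa [show j - u + u = j by omega] at ho
  · rintro ⟨hst, v, h1, h2, hv⟩
    refine ⟨by omega, fun j => v (j + u) - a, by simp [h1], by simp [h2], fun j h1 h2 => ?_⟩
    obtain ⟨e, he, ho⟩ := hv (j + u) (by omega) (by omega)
    refine ⟨e, ?_, ?_⟩
    · have : j + 1 + u = j + u + 1 := by omega
      simp only [this, he]; ring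
    · simp only [shf]
      rwa [show v (j + u) - a + a = v (j+u) by ring]

/-- spatial reflection -/
def rfx (b : Bd) : Bd := (-b.1, b.2.1, !b.2.2)

lemma rfx_inj : Function.Injective rfx := by
  rintro ⟨x, s, e⟩ ⟨y, r, f⟩ h
  simp only [rfx, Prod.mk.injEq, neg_inj, Bool.not_inj_iff] at h ⊢
  exact h

lemma stp_not (e : Bool) : stp (!e) = - stp e := by cases e <;> simp [stp]

lemma conn_rfx {ω : Om} {x : ℤ} {s : ℕ} {y : ℤ} {t : ℕ} (h : Conn (fun b => ω (rfx b)) x s y t) :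
    Conn ω (-x) s (-y) t := by
  obtain ⟨hst, v, rfl, rfl, hv⟩ := h
  refine ⟨by omega, fun j => - v j, by simp, by simp, fun j h1 h2 => ?_⟩
  obtain ⟨e, he, ho⟩ := hv j h1 h2
  refine ⟨!e, ?_, ho⟩
  simp only [he, stp_not]; ring

/-- point reflection -/
def prf (x : ℤ) (t : ℕ) (b : Bd) : Bd :=
  if b.2.1 < t then (x - b.1 - stp b.2.2, t - 1 - b.2.1, b.2.2) else b

lemma prf_invol (x : ℤ) (t : ℕ) (b : Bd) : prf x t (prf x t b) = b := by
  obtain ⟨a, s, e⟩ := b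
  unfold prf
  by_cases h : s < t
  · have h' : t - 1 - s < t := by omega
    simp only [if_pos h, if_pos h', Prod.mk.injEq]
    refine ⟨by ring, by omega, trivial⟩
  · simp only [if_neg h]

lemma prf_inj (x : ℤ) (t : ℕ) : Function.Injective (prf x t) :=
  (Function.Involutive.injective (prf_invol x t))

lemma pth_prf {ω : Om} {x : ℤ} {t : ℕ} {v : ℕ → ℤ} {s r : ℕ} (h : Pth (fun b => ω (prf x t b)) v s r)
    (hr : r ≤ t) : Pth ω (fun j => x - v (t - j)) (t - r) (t - s) := by
  intro j h1 h2
  obtain ⟨e, he, ho⟩ := h (t - (j + 1)) (by omega) (by omega)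
  have e1 : t - (j+1) + 1 = t - j := by omega
  rw [e1] at he
  have h3 : t - (j+1) < t := by omega
  simp only [prf, if_pos h3] at ho
  refine ⟨e, ?_, ?_⟩
  · simp only [he]; ring
  · have e2 : t - 1 - (t - (j+1)) = j := by omega
    rw [e2] at ho
    simp only [he]
    rwa [← sub_sub]

lemma conn_prf {ω : Om} {x : ℤ} {t : ℕ} {a b : ℤ} {s r : ℕ} (h : Conn (fun b => ω (prf x t b)) a s b r)
    (hr : r ≤ t) : Conn ω (x - b) (t - r) (x - a) (t - s) := by
  obtain ⟨hst, v, rfl, rfl, hv⟩ := h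
  refine ⟨by omega, _, ?_, ?_, pth_prf hv hr⟩
  · congr 2; omega
  · congr 2; omega



/-! ### Basic probability estimates -/

/-- half-line crossing probability -/
noncomputable def DD (q : ℝ) (t : ℕ) (x : ℤ) : ℝ := Pr q (HL 0 0 x t)
/-- half-line hitting probability -/
noncomputable def ff (q : ℝ) (t : ℕ) (x : ℤ) : ℝ := Pr q (Hit 0 0 x t)
/-- hitting probability from the origin -/
noncomputable def NN (q : ℝ) (t : ℕ) (x : ℤ) : ℝ := Pr q (Nh x t)
/-- one-sided probability -/
noncomputable def RR (q : ℝ) (t : ℕ) (x : ℤ) : ℝ := Pr q (Rr x t)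
/-- survival probability -/
noncomputable def th (q : ℝ) (t : ℕ) : ℝ := Pr q (Th t)
/-- two-point function -/
noncomputable def ta (q : ℝ) (t : ℕ) (x : ℤ) : ℝ := Pr q (Ta x t)

lemma pr_HL (q : ℝ) (a : ℤ) {s t : ℕ} (hst : s ≤ t) (x : ℤ) : Pr q (HL a s x t) = DD q (t - s) (x - a) := by
  unfold DD
  rw [← pr_inv q (shf_inj a s) (HL_fin 0 0 (x - a) (t - s))]
  congr 1
  ext ω
  simp only [HL, mem_ofPred_eq, conn_shf, zero_add, Nat.sub_add_cancel hst]
  constructor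
  · rintro ⟨z, y, h1, h2, h3, h4⟩
    exact ⟨z - a, y - a, by omega, by omega, by omega, by simpa using h4⟩
  · rintro ⟨z, y, h1, h2, h3, h4⟩
    exact ⟨z + a, y + a, by omega, by omega, by omega, h4⟩

lemma pr_Hit (q : ℝ) (a : ℤ) {s t : ℕ} (hst : s ≤ t) (x : ℤ) : Pr q (Hit a s x t) = ff q (t - s) (x - a) := by
  unfold ff
  rw [← pr_inv q (shf_inj a s) (Hit_fin 0 0 (x - a) (t - s))]
  congr 1
  ext ω
  simp only [Hit, mem_ofPred_eq, conn_shf, zero_add]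
  constructor
  · rintro ⟨z, r, h1, h2, h3, h4⟩
    have := h4.le
    exact ⟨z - a, r - s, by omega, by omega, by omega, by simpa [Nat.sub_add_cancel this] using h4⟩
  · rintro ⟨z, r, h1, h2, h3, h4⟩
    exact ⟨z + a, r + s, by omega, by omega, by omega, by simpa using h4⟩

lemma ff_mono (q : ℝ) {s t : ℕ} (h : s ≤ t) (x : ℤ) : ff q s x ≤ ff q t x := by
  refine pr_mono ?_
  rintro ω ⟨z, r, h1, h2, h3, h4⟩
  exact ⟨z, r, h1, h2, by omega, h4⟩

lemma ff_nonneg (q : ℝ) (t : ℕ) (x : ℤ) : 0 ≤ ff q t x := pr_nonneg _ _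
lemma DD_nonneg (q : ℝ) (t : ℕ) (x : ℤ) : 0 ≤ DD q t x := pr_nonneg _ _
lemma NN_nonneg (q : ℝ) (t : ℕ) (x : ℤ) : 0 ≤ NN q t x := pr_nonneg _ _
lemma RR_nonneg (q : ℝ) (t : ℕ) (x : ℤ) : 0 ≤ RR q t x := pr_nonneg _ _
lemma th_nonneg (q : ℝ) (t : ℕ) : 0 ≤ th q t := pr_nonneg _ _
lemma th_le_one (q : ℝ) (t : ℕ) : th q t ≤ 1 := pr_le_one _ _
lemma ta_nonneg (q : ℝ) (t : ℕ) (x : ℤ) : 0 ≤ ta q t x := pr_nonneg _ _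

lemma DD_anti (q : ℝ) (t : ℕ) {x y : ℤ} (h : x ≤ y) : DD q t y ≤ DD q t x := by
  refine pr_mono ?_
  rintro ω ⟨z, y, h1, h2, h3, h4⟩
  exact ⟨z, y, h1, h2, by omega, h4⟩

lemma ff_zero (q : ℝ) (t : ℕ) {x : ℤ} (h : (t : ℤ) < x) : ff q t x = 0 := by
  unfold ff
  rw [← pr_empty q]; congr 1
  rw [Set.eq_empty_iff_forall_notMem]
  rintro ω ⟨z, r, h1, h2, h3, h4⟩
  have := h4.bound.1
  rw [abs_le] at this; omega

lemma DD_zero (q : ℝ) (t : ℕ) {x : ℤ} (h : (t : ℤ) < x) : DD q t x = 0 := by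
  unfold DD
  rw [← pr_empty q]; congr 1
  rw [Set.eq_empty_iff_forall_notMem]
  rintro ω ⟨z, r, h1, h2, h3, h4⟩
  have := h4.bound.1
  rw [abs_le] at this; omega

lemma ta_zero (q : ℝ) (t : ℕ) {x : ℤ} (h : (t : ℤ) < |x|) : ta q t x = 0 := by
  unfold ta
  rw [← pr_empty q]; congr 1
  rw [Set.eq_empty_iff_forall_notMem]
  intro ω h4
  have := (Conn.bound h4).1
  simp at this; omega

lemma Pth.ivt {ω : Om} {v : ℕ → ℤ} {s r : ℕ} (h : Pth ω v s r) (hsr : s ≤ r) {x : ℤ} (h1 : v s ≤ x) (h2 : x ≤ v r) :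
    ∃ j, s ≤ j ∧ j ≤ r ∧ v j = x := by
  induction r, hsr using Nat.le_induction with
  | base => exact ⟨s, le_rfl, le_rfl, by omega⟩
  | succ r hsr ih =>
    by_cases hx : x ≤ v r
    · obtain ⟨j, a, b, c⟩ := ih (h.mono le_rfl (by omega)) hx
      exact ⟨j, a, by omega, c⟩
    · obtain ⟨e, he, -⟩ := h r hsr (by omega)
      refine ⟨r + 1, by omega, le_rfl, ?_⟩
      rcases stp_cases e with h' | h' <;> rw [h'] at he <;> omega

lemma DD_le_ff (q : ℝ) (t : ℕ) {x : ℤ} (hx : 0 ≤ x) : DD q t x ≤ ff q t x := by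
  refine pr_mono ?_
  rintro ω ⟨z, y, h1, h2, h3, hst, v, rfl, rfl, hv⟩
  obtain ⟨j, a, b, c⟩ := hv.ivt (x := x) hst (by omega) h3
  exact ⟨v 0, j, h1, h2, b, c ▸ hv.conn le_rfl a b⟩

/-- the origin reaches the left at time `t` -/
def Ll (t : ℕ) : Set Om := {ω | ∃ y, y ≤ 0 ∧ Conn ω 0 0 y t}

lemma Ll_dep (t : ℕ) : Dep (GB t 0 t) (Ll t) := by
  rintro ω ω' h ⟨y, h1, h2⟩
  exact ⟨y, h1, h2.transfer h (by simp) le_rfl le_rfl⟩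

lemma Rr_le_Ll (q : ℝ) (t : ℕ) : Pr q (Rr 0 t) ≤ Pr q (Ll t) := by
  rw [← pr_inv q rfx_inj (Rr_fin 0 t)]
  refine pr_mono ?_
  rintro ω ⟨y, h1, h2⟩
  exact ⟨-y, by omega, by simpa using conn_rfx h2⟩

lemma Ll_le_Rr (q : ℝ) (t : ℕ) : Pr q (Ll t) ≤ Pr q (Rr 0 t) := by
  rw [← pr_inv q rfx_inj (Ll_dep t).fin]
  refine pr_mono ?_
  rintro ω ⟨y, h1, h2⟩
  exact ⟨-y, by omega, by simpa using conn_rfx h2⟩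

lemma ta_neg_le (q : ℝ) (t : ℕ) (x : ℤ) : ta q t x ≤ ta q t (-x) := by
  unfold ta
  rw [← pr_inv q rfx_inj (Ta_fin x t)]
  refine pr_mono ?_
  intro ω h
  have := conn_rfx (ω := ω) h
  simpa [Ta] using this

lemma ta_neg (q : ℝ) (t : ℕ) (x : ℤ) : ta q t (-x) = ta q t x :=
  le_antisymm (by simpa using ta_neg_le q t (-x)) (ta_neg_le q t x)

lemma th_le (q : ℝ) (t : ℕ) : th q t ≤ 2 * RR q t 0 := by
  have h : Th t ⊆ Rr 0 t ∪ Ll t := by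
    rintro ω ⟨y, h⟩
    rcases le_total 0 y with h0 | h0
    · exact Or.inl ⟨y, h0, h⟩
    · exact Or.inr ⟨y, h0, h⟩
  have h1 := pr_mono (q := q) h
  have h2 := pr_union_le q (Rr 0 t) (Ll t)
  have h3 := Ll_le_Rr q t
  unfold th RR; linarith

lemma RR_le_DD (q : ℝ) (t : ℕ) (x : ℤ) : RR q t x ≤ DD q t x := by
  refine pr_mono ?_
  rintro ω ⟨y, h1, h2⟩
  exact ⟨0, y, le_rfl, by simp, h1, h2⟩

lemma th_DD_le_RR {q : ℝ} (hq : q ∈ Icc (0:ℝ) 1) (t : ℕ) (x : ℤ) : th q t * DD q t x ≤ RR q t x := by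
  refine (fkg hq (Th_fin t) (HL_fin 0 0 x t) (Th_inc t) (HL_inc _ _ _ _)).trans (pr_mono ?_)
  rintro ω ⟨⟨y', h'⟩, z, y, h1, h2, h3, h4⟩
  by_cases hx : x ≤ y'
  · exact ⟨y', hx, h'⟩
  · exact ⟨y, h3, (h4.cross h' h2 h1 (by omega)).2⟩

lemma ta_ge_aux {q : ℝ} (hq : q ∈ Icc (0:ℝ) 1) (t : ℕ) {x : ℤ} (hx : 0 ≤ x) (hp : 2 ∣ x - t) :
    RR q t x * RR q t 0 ≤ ta q t x := by
  let B : Set Om := {ω | ∃ z, 0 ≤ z ∧ Conn ω z 0 x t}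
  have dB : Dep (GB (|x| + 2 * t) 0 t) B := by
    rintro ω ω' h ⟨z, h1, h2⟩
    refine ⟨z, h1, h2.transfer h ?_ le_rfl le_rfl⟩
    have := h2.bound.1
    rcases abs_cases z with ⟨u, _⟩ | ⟨u, _⟩ <;> rcases abs_cases x with ⟨u3, _⟩ | ⟨u3, _⟩ <;> rw [abs_le] at this <;> omega
  have iB : Inc B := by
    rintro ω ω' h ⟨z, h1, h2⟩; exact ⟨z, h1, h2.inc h⟩
  have hB : RR q t 0 ≤ Pr q B := by
    refine (Rr_le_Ll q t).trans ?_
    rw [← pr_inv q (prf_inj x t) (Ll_dep t).fin]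
    refine pr_mono ?_
    rintro ω ⟨y, h1, h2⟩
    have := conn_prf h2 le_rfl
    refine ⟨x - y, by omega, by simpa using this⟩
  have h1 := fkg hq (Rr_fin x t) dB.fin (Rr_inc x t) iB
  have h2 : Rr x t ∩ B ⊆ Ta x t := by
    rintro ω ⟨⟨y, a1, a2⟩, z, b1, b2⟩
    have := b2.bound.2
    exact (a2.cross b2 (by push_cast at this; omega) b1 a1).1
  have h3 := mul_le_mul_of_nonneg_left hB (RR_nonneg q t x)
  exact h3.trans (h1.trans (pr_mono h2))

lemma ta_ge {q : ℝ} (hq : q ∈ Icc (0:ℝ) 1) (t : ℕ) {x : ℤ} (hx : 0 ≤ x) (hp : 2 ∣ x - t) :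
    th q t ^ 2 / 2 * DD q t x ≤ ta q t x := by
  have h1 := ta_ge_aux hq t hx hp
  have h2 := th_DD_le_RR hq t x
  have h3 := th_le q t
  have h4 := th_nonneg q t
  have h5 := DD_nonneg q t x
  calc th q t ^ 2 / 2 * DD q t x = (th q t * DD q t x) * (th q t / 2) := by ring
    _ ≤ RR q t x * RR q t 0 := mul_le_mul h2 (by linarith) (by linarith) (RR_nonneg _ _ _)
    _ ≤ _ := h1

/-! ### First hitting decompositions -/

/-- bonds before time `s` -/
def TB (s : ℕ) : Set Bd := {b | b.2.1 < s}

lemma GB_TB (M : ℤ) (S s : ℕ) : GB M S s ⊆ TB s := fun _ h => h.2.2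
lemma GB_TBc (M : ℤ) (s T : ℕ) : GB M s T ⊆ (TB s)ᶜ := fun b h h' => by
  have h1 : s ≤ b.2.1 := h.2.1
  have h2 : b.2.1 < s := h'
  omega

/-- first occurrence -/
def Fst (E : ℕ → Set Om) (s : ℕ) : Set Om := E s ∩ {ω | ∀ r < s, ω ∉ E r}

lemma Fst_dep (E : ℕ → Set Om) (G : ℕ → Set Bd) (hm : Monotone G) (h : ∀ s, Dep (G s) (E s)) (s : ℕ) :
    Dep (G s) (Fst E s) := by
  rintro ω ω' hω ⟨h1, h2⟩
  refine ⟨h s ω ω' hω h1, fun r hr hn => h2 r hr ?_⟩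
  exact (h r).mono (hm hr.le) ω' ω (fun b hb => (hω b hb).symm) hn

lemma GB_mono (M : ℤ) : Monotone (fun s => GB M 0 s) := by
  intro s t hst b hb
  exact ⟨hb.1, hb.2.1, lt_of_lt_of_le hb.2.2 hst⟩

lemma Fst_disj (E : ℕ → Set Om) {i j : ℕ} (h : i ≠ j) : Disjoint (Fst E i) (Fst E j) := by
  rw [Set.disjoint_left]
  rintro ω ⟨h1, h2⟩ ⟨h3, h4⟩
  rcases lt_or_gt_of_ne h with h | h
  · exact h4 i h h1
  · exact h2 j h h3

lemma Fst_exists (E : ℕ → Set Om) {ω : Om} {r : ℕ} (h : ω ∈ E r) : ∃ s ≤ r, ω ∈ Fst E s := by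
  have hex : ∃ r, ω ∈ E r := ⟨r, h⟩
  exact ⟨Nat.find hex, Nat.find_min' hex h, Nat.find_spec hex, fun r hr => Nat.find_min hex hr⟩

lemma Fst_sum {q : ℝ} (E : ℕ → Set Om) (S : Set Om) (M : ℤ) (hE : ∀ s, Dep (GB M 0 s) (E s)) (hS : FinDep S) (t : ℕ) :
    ∑ s ∈ Finset.range (t+1), Pr q (Fst E s ∩ S) = Pr q ({ω | ∃ r ≤ t, ω ∈ E r} ∩ S) := by
  rw [← pr_sum_disj]
  · congr 1
    ext ω
    simp only [mem_iUnion, Finset.mem_range, mem_inter_iff, mem_ofPred_eq, exists_prop]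
    constructor
    · rintro ⟨s, hs, h1, h2⟩; exact ⟨⟨s, by omega, h1.1⟩, h2⟩
    · rintro ⟨⟨r, hr, h1⟩, h2⟩
      obtain ⟨s, hs, h3⟩ := Fst_exists E h1
      exact ⟨s, by omega, h3, h2⟩
  · intro s _
    exact (Fst_dep E _ (GB_mono M) hE s).fin.inter hS
  · intro i _ j _ hij
    exact (Fst_disj E hij).mono inter_subset_left inter_subset_left

lemma first_bound {q : ℝ} (hq : q ∈ Icc (0:ℝ) 1) (E : ℕ → Set Om) (M : ℤ) (hE : ∀ s, Dep (GB M 0 s) (E s)) (t : ℕ)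
    (W : Set Om) (K : ℕ → Set Om) (hK : ∀ s ≤ t, FinDep (K s)) (dK : ∀ s ≤ t, Dep (TB s)ᶜ (K s)) (c : ℝ)
    (hc : ∀ s ≤ t, Pr q (K s) ≤ c) (hW : ∀ ω ∈ W, ∃ s ≤ t, ω ∈ Fst E s ∧ ω ∈ K s) :
    Pr q W ≤ Pr q {ω | ∃ r ≤ t, ω ∈ E r} * c := by
  have dF : ∀ s, Dep (GB M 0 s) (Fst E s) := Fst_dep E _ (GB_mono M) hE
  have h1 : Pr q W ≤ Pr q (⋃ s ∈ Finset.range (t+1), (Fst E s ∩ K s)) := by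
    refine pr_mono fun ω hω => ?_
    obtain ⟨s, hs, h1, h2⟩ := hW ω hω
    simp only [mem_iUnion, Finset.mem_range, exists_prop]
    exact ⟨s, by omega, h1, h2⟩
  rw [pr_sum_disj] at h1
  · have h2 := Fst_sum (q := q) E univ M hE ⟨∅, fun _ _ _ _ => trivial⟩ t
    simp only [inter_univ] at h2
    rw [← h2, Finset.sum_mul]
    refine h1.trans (Finset.sum_le_sum fun s hs => ?_)
    have hs' : s ≤ t := by simpa [Nat.lt_succ_iff] using hs
    rw [indep hq (TB s) (dF s).fin (hK s hs') ((dF s).mono (GB_TB _ _ _)) (dK s hs')]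
    exact mul_le_mul_of_nonneg_left (hc s hs') (pr_nonneg _ _)
  · intro s hs
    have hs' : s ≤ t := by simpa [Nat.lt_succ_iff] using hs
    exact (dF s).fin.inter (hK s hs')
  · intro i _ j _ hij
    exact (Fst_disj E hij).mono inter_subset_left inter_subset_left

/-- the half line hits `x` exactly at time `r` -/
def EH (x : ℤ) (r : ℕ) : Set Om := {ω | ∃ z, z ≤ 0 ∧ 2 ∣ (0 : ℤ) - z ∧ Conn ω z 0 x r}

lemma EH_dep (x : ℤ) (t r : ℕ) (hr : r ≤ t) : Dep (GB (|x| + 2 * t) 0 r) (EH x r) := by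
  rintro ω ω' h ⟨z, h1, h2, h4⟩
  refine ⟨z, h1, h2, h4.transfer h ?_ le_rfl le_rfl⟩
  have b := h4.bound.1
  rcases abs_cases z with ⟨u, _⟩ | ⟨u, _⟩ <;>
    rcases abs_cases x with ⟨u3, _⟩ | ⟨u3, _⟩ <;> rw [abs_le] at b <;> omega

/-- truncated version -/
def EHt (x : ℤ) (t : ℕ) (r : ℕ) : Set Om := if r ≤ t then EH x r else ∅

lemma EHt_dep (x : ℤ) (t r : ℕ) : Dep (GB (|x| + 2 * t) 0 r) (EHt x t r) := by
  unfold EHt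
  split_ifs with h
  · exact EH_dep x t r h
  · intro ω ω' _ h; exact h

lemma Hit_eq (x : ℤ) (t : ℕ) : {ω | ∃ r ≤ t, ω ∈ EHt x t r} = Hit 0 0 x t := by
  ext ω
  simp only [EHt, Hit, mem_ofPred_eq]
  constructor
  · rintro ⟨r, hr, h⟩
    rw [if_pos hr] at h
    obtain ⟨z, h1, h2, h3⟩ := h
    exact ⟨z, r, h1, h2, hr, h3⟩
  · rintro ⟨z, r, h1, h2, hr, h3⟩
    exact ⟨r, hr, by rw [if_pos hr]; exact ⟨z, h1, h2, h3⟩⟩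

lemma ff_mul {q : ℝ} (hq : q ∈ Icc (0:ℝ) 1) (t : ℕ) {x y : ℤ} (hx : 0 ≤ x) (hy : 0 ≤ y) :
    ff q t (x + y) ≤ ff q t x * ff q t y := by
  have := first_bound hq (EHt x t) _ (EHt_dep x t) t (Hit 0 0 (x + y) t) (fun s => Hit x s (x + y) t)
    (fun s _ => Hit_fin _ _ _ _) (fun s _ => (Hit_dep _ _ _ _).mono (GB_TBc _ _ _)) (ff q t y) ?_ ?_
  · rw [Hit_eq] at this; exact this
  · intro s hs
    rw [pr_Hit q x hs, show x + y - x = y by ring]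
    exact ff_mono q (by omega) y
  · rintro ω ⟨z, r, h1, h2, h3, hr0, v, hz, hxy, hv⟩
    have hpre : ∀ i ≤ r, x ≤ v i → ∃ j ≤ i, ω ∈ EHt x t j ∧ v j = x := by
      intro i hi hxi
      obtain ⟨j, a, b, c⟩ := (hv.mono le_rfl hi).ivt (x := x) (Nat.zero_le i) (by omega) hxi
      refine ⟨j, b, ?_, c⟩
      simp only [EHt, if_pos (show j ≤ t by omega)]
      exact ⟨z, h1, h2, by rw [← hz, ← c]; exact hv.conn le_rfl a (by omega)⟩
    obtain ⟨j, hj, hjE, -⟩ := hpre r le_rfl (by omega)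
    obtain ⟨s, hs, hF⟩ := Fst_exists _ hjE
    refine ⟨s, by omega, hF, ?_⟩
    have hvs : v s ≤ x := by
      by_contra hcon
      obtain ⟨i, hi, hiE, hiv⟩ := hpre s (by omega) (by omega)
      rcases hi.eq_or_lt with rfl | hlt
      · omega
      · exact hF.2 i hlt hiE
    have hsE := hF.1
    simp only [EHt, if_pos (show s ≤ t by omega)] at hsE
    obtain ⟨z', g1, g2, g3⟩ := hsE
    have b1 := g3.bound.2
    have b2 := (hv.bound (i := 0) (j := s) le_rfl (by omega) (by omega)).2
    exact ⟨v s, r, hvs, by push_cast at b1 b2; omega, h3, by rw [← hxy]; exact hv.conn (by omega) (by omega) le_rfl⟩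

lemma NN_mul {q : ℝ} (hq : q ∈ Icc (0:ℝ) 1) (t : ℕ) {x y : ℤ} (hx : 0 ≤ x) (hy : 0 ≤ y) :
    NN q t (x + y) ≤ NN q t x * ff q t y := by
  have hd : ∀ s, Dep (GB t 0 s) (if s ≤ t then Ta x s else ∅) := by
    intro s
    split_ifs with h
    · refine (Ta_dep x s).mono ?_
      intro b hb
      have h1 : |b.1| ≤ (s:ℤ) := hb.1
      exact ⟨by omega, hb.2⟩
    · intro ω ω' _ h; exact h
  have := first_bound hq (fun s => if s ≤ t then Ta x s else ∅) _ hd t (Nh (x + y) t) (fun s => Hit x s (x + y) t)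
    (fun s _ => Hit_fin _ _ _ _) (fun s _ => (Hit_dep _ _ _ _).mono (GB_TBc _ _ _)) (ff q t y) ?_ ?_
  · refine this.trans (mul_le_mul_of_nonneg_right (pr_mono ?_) (ff_nonneg _ _ _))
    rintro ω ⟨r, hr, h⟩
    simp only [if_pos hr] at h
    exact ⟨r, hr, h⟩
  · intro s hs
    rw [pr_Hit q x hs, show x + y - x = y by ring]
    exact ff_mono q (by omega) y
  · rintro ω ⟨r, h3, hr0, v, hz, hxy, hv⟩
    have hpre : ∀ i ≤ r, x ≤ v i → ∃ j ≤ i, ω ∈ (if j ≤ t then Ta x j else ∅) ∧ v j = x := by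
      intro i hi hxi
      obtain ⟨j, a, b, c⟩ := (hv.mono le_rfl hi).ivt (x := x) (Nat.zero_le i) (by omega) hxi
      refine ⟨j, b, ?_, c⟩
      rw [if_pos (show j ≤ t by omega)]
      have := hv.conn le_rfl a (show j ≤ r by omega)
      rw [hz, c] at this
      exact this
    obtain ⟨j, hj, hjE, -⟩ := hpre r le_rfl (by omega)
    obtain ⟨s, hs, hF⟩ := Fst_exists (fun s => if s ≤ t then Ta x s else ∅) hjE
    refine ⟨s, by omega, hF, ?_⟩
    have hvs : v s ≤ x := by
      by_contra hcon
      obtain ⟨i, hi, hiE, hiv⟩ := hpre s (by omega) (by omega)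
      rcases hi.eq_or_lt with rfl | hlt
      · omega
      · exact hF.2 i hlt hiE
    have hsE := hF.1
    simp only [if_pos (show s ≤ t by omega)] at hsE
    have b1 := (Conn.bound hsE).2
    have b2 := (hv.bound (i := 0) (j := s) le_rfl (by omega) (by omega)).2
    exact ⟨v s, r, hvs, by push_cast at b1 b2; omega, h3, by rw [← hxy]; exact hv.conn (by omega) (by omega) le_rfl⟩

lemma ff_le_one (q : ℝ) (t : ℕ) (x : ℤ) : ff q t x ≤ 1 := pr_le_one _ _
lemma DD_le_one (q : ℝ) (t : ℕ) (x : ℤ) : DD q t x ≤ 1 := pr_le_one _ _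

lemma ff_anti {q : ℝ} (hq : q ∈ Icc (0:ℝ) 1) (t : ℕ) {x y : ℤ} (hx : 0 ≤ x) (hy : x ≤ y) : ff q t y ≤ ff q t x := by
  have := ff_mul hq t hx (y := y - x) (by omega)
  rw [show x + (y - x) = y by ring] at this
  nlinarith [ff_nonneg q t x, ff_le_one q t (y - x)]

lemma NN_anti {q : ℝ} (hq : q ∈ Icc (0:ℝ) 1) (t : ℕ) {x y : ℤ} (hx : 0 ≤ x) (hy : x ≤ y) : NN q t y ≤ NN q t x := by
  have := NN_mul hq t hx (y := y - x) (by omega)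
  rw [show x + (y - x) = y by ring] at this
  nlinarith [NN_nonneg q t x, ff_le_one q t (y - x)]



/-! ### The main correlation estimates -/

lemma main_push {q : ℝ} (hq : q ∈ Icc (0:ℝ) 1) (t : ℕ) {k : ℤ} (hk : 0 ≤ k) {c : ℝ}
    (hc : ∀ s ≤ t, c ≤ DD q s (-k)) : ff q t (4 * k) * DD q t (-k) * c ≤ 2 * DD q t k := by
  set S := HL (2 * k) 0 k t with hS
  have pS : Pr q S = DD q t (-k) := by
    rw [hS, pr_HL q (2 * k) (Nat.zero_le t)]; congr 1; ring
  set E := EHt (4 * k) t with hE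
  have dE := EHt_dep (4 * k) t
  have dF := Fst_dep E _ (GB_mono (|4 * k| + 2 * t)) dE
  have h1 := fkg hq (Hit_fin 0 0 (4 * k) t) (HL_fin (2 * k) 0 k t) (Hit_inc _ _ _ _) (HL_inc _ _ _ _)
  rw [← hS, pS] at h1
  have h2 := Fst_sum (q := q) E S _ dE (HL_fin (2 * k) 0 k t) t
  rw [hE, Hit_eq, ← hE] at h2
  have h3 : ∀ s ∈ Finset.range (t+1), Pr q (Fst E s ∩ S) * c ≤ Pr q (Fst E s ∩ S ∩ HL (4 * k) s (3 * k) t) := by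
    intro s hs
    have hs' : s ≤ t := by simpa [Nat.lt_succ_iff] using hs
    have p1 : c ≤ Pr q (HL (4 * k) s (3 * k) t) := by
      rw [pr_HL q _ hs', show 3 * k - 4 * k = -k by ring]
      exact hc _ (by omega)
    refine (mul_le_mul_of_nonneg_left p1 (pr_nonneg _ _)).trans ?_
    exact cfkg hq (TB s) (dF s).fin (HL_fin _ _ _ _) (HL_fin _ _ _ _) (HL_inc _ _ _ _) (HL_inc _ _ _ _)
      ((dF s).mono (GB_TB _ _ _)) ((HL_dep _ _ _ _).mono (GB_TBc _ _ _))
  have h4 : ∑ s ∈ Finset.range (t+1), Pr q (Fst E s ∩ S ∩ HL (4 * k) s (3 * k) t) ≤ 2 * DD q t k := by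
    rw [← pr_sum_disj]
    · have hsub : (⋃ s ∈ Finset.range (t+1), (Fst E s ∩ S ∩ HL (4 * k) s (3 * k) t)) ⊆
          HL 0 0 k t ∪ HL (2 * k) 0 (3 * k) t := by
        intro ω hω
        simp only [mem_iUnion, Finset.mem_range, exists_prop] at hω
        obtain ⟨s, hs, ⟨⟨hF, -⟩, z1, y1, a1, a2, a3, a4⟩, z2, y2, b1, b2, b3, b4⟩ := hω
        simp only [hE, EHt, if_pos (show s ≤ t by omega)] at hF
        obtain ⟨z, c1, c2, c3⟩ := hF
        by_cases hz : z1 ≤ 0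
        · exact Or.inl ⟨z1, y1, hz, by omega, a3, a4⟩
        obtain ⟨w, w1, w2⟩ := a4.split (Nat.zero_le s) (show s ≤ t by omega)
        have e1 := w1.bound.2
        have e3 := c3.bound.2
        push_cast at e1 e3
        by_cases hw : w ≤ 4 * k
        · exact Or.inl ⟨z, y1, c1, c2, a3, ((c3.cross w1 (by omega) (by omega) hw).1).trans w2⟩
        · by_cases hy : 3 * k ≤ y1
          · exact Or.inr ⟨z1, y1, a1, a2, hy, a4⟩
          · exact Or.inr ⟨z1, y2, a1, a2, b3, w1.trans (b4.cross w2 (by omega) (by omega) (by omega)).2⟩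
      refine (pr_mono hsub).trans ((pr_union_le _ _ _).trans ?_)
      rw [pr_HL q (2 * k) (Nat.zero_le t), show 3 * k - 2 * k = k by ring, Nat.sub_zero]
      unfold DD; linarith
    · intro s _
      exact ((dF s).fin.inter (HL_fin _ _ _ _)).inter (HL_fin _ _ _ _)
    · intro i _ j _ hij
      exact (Fst_disj E hij).mono (inter_subset_left.trans inter_subset_left) (inter_subset_left.trans inter_subset_left)
  have h5 := Finset.sum_le_sum h3
  rw [← Finset.sum_mul, h2] at h5
  by_cases hc0 : 0 ≤ c
  · exact (mul_le_mul_of_nonneg_right h1 hc0).trans (h5.trans h4)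
  · have : ff q t (4 * k) * DD q t (-k) * c ≤ 0 :=
      mul_nonpos_of_nonneg_of_nonpos (mul_nonneg (ff_nonneg _ _ _) (DD_nonneg _ _ _)) (by linarith)
    linarith [DD_nonneg q t k]

/-- path staying left -/
def VV (n : ℤ) (t : ℕ) : Set Om :=
  {ω | ∃ v : ℕ → ℤ, 0 ≤ v 0 ∧ 2 ∣ v 0 ∧ (∀ j ≤ t, v j ≤ 4 * n) ∧ Pth ω v 0 t}

lemma Pth.inc {ω ω' : Om} {v : ℕ → ℤ} {s r : ℕ} (h : Pth ω v s r) (hω : ∀ b, ω b = true → ω' b = true) :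
    Pth ω' v s r := by
  intro j a b
  obtain ⟨e, he, ho⟩ := h j a b
  exact ⟨e, he, hω _ ho⟩

lemma VV_dep (n : ℤ) (t : ℕ) : Dep (GB (|4 * n| + t) 0 t) (VV n t) := by
  rintro ω ω' h ⟨v, h1, h2, h3, h4⟩
  refine ⟨v, h1, h2, h3, h4.transfer h fun j e a b _ => ⟨?_, by simp, by simpa using b⟩⟩
  have b1 := (h4.bound le_rfl a b.le).1
  have b2 := h3 0 (by omega)
  simp only
  rcases abs_cases (v j) with ⟨u, _⟩ | ⟨u, _⟩ <;> rcases abs_cases (4 * n) with ⟨u2, _⟩ | ⟨u2, _⟩ <;>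
     rw [abs_le] at b1 <;> push_cast at b1 <;> omega

lemma VV_inc (n : ℤ) (t : ℕ) : Inc (VV n t) := by
  rintro ω ω' h ⟨v, h1, h2, h3, h4⟩
  exact ⟨v, h1, h2, h3, h4.inc h⟩

lemma VV_ge (q : ℝ) (t : ℕ) {n : ℤ} (hn : 0 ≤ n) :
    DD q t (-n) - ff q t n - ff q t (2 * n + 1) ≤ Pr q (VV n t) := by
  have hsub : HL (2 * n) 0 n t ⊆ VV n t ∪ Hit 0 0 n t ∪ Hit (2 * n) 0 (4 * n + 1) t := by
    rintro ω ⟨z, y, h1, h2, h3, h0, v, rfl, rfl, hv⟩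
    by_cases hz : v 0 ≤ 0
    · obtain ⟨j, a, b, c⟩ := hv.ivt (x := n) h0 (by omega) h3
      exact Or.inl (Or.inr ⟨v 0, j, hz, by omega, b, c ▸ hv.conn le_rfl a b⟩)
    · by_cases hm : ∀ j ≤ t, v j ≤ 4 * n
      · exact Or.inl (Or.inl ⟨v, by omega, by omega, hm, hv⟩)
      · push Not at hm
        obtain ⟨i, hi, hi2⟩ := hm
        obtain ⟨j, a, b, c⟩ := (hv.mono le_rfl hi).ivt (x := 4 * n + 1) (Nat.zero_le i) (by omega) (by omega)
        exact Or.inr ⟨v 0, j, h1, h2, by omega, c ▸ hv.conn le_rfl a (by omega)⟩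
  have h1 := pr_mono (q := q) hsub
  have h2 := pr_union_le q (VV n t ∪ Hit 0 0 n t) (Hit (2 * n) 0 (4 * n + 1) t)
  have h3 := pr_union_le q (VV n t) (Hit 0 0 n t)
  rw [pr_HL q _ (Nat.zero_le t), show n - 2 * n = -n by ring, Nat.sub_zero] at h1
  rw [pr_Hit q _ (Nat.zero_le t), show 4 * n + 1 - 2 * n = 2 * n + 1 by ring, Nat.sub_zero] at h2
  unfold ff at *
  linarith

lemma NN_VV {q : ℝ} (hq : q ∈ Icc (0:ℝ) 1) (t : ℕ) {n : ℤ} (hn : 0 ≤ n) :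
    NN q t (4 * n) * Pr q (VV n t) ≤ th q t := by
  refine (fkg hq (Nh_fin _ _) (VV_dep n t).fin (Nh_inc _ _) (VV_inc n t)).trans (pr_mono ?_)
  rintro ω ⟨⟨r, h1, h2⟩, v, a1, a2, a3, a4⟩
  have c1 := a4.conn le_rfl (Nat.zero_le r) h1
  have c2 := a4.conn (Nat.zero_le r) h1 le_rfl
  exact ⟨v t, (h2.cross c1 (by omega) a1 (a3 r h1)).1.trans c2⟩

lemma ta_le {q : ℝ} (hq : q ∈ Icc (0:ℝ) 1) (t : ℕ) {x a : ℤ} (ha : 0 ≤ a) (hax : a ≤ x) :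
    ta q t x ≤ NN q t a * NN q t (x - a) := by
  let G : Set Bd := {b | b.1 ≤ a ∧ b.1 + stp b.2.2 ≤ a}
  let A : Set Om := {ω | ∃ (r : ℕ) (v : ℕ → ℤ), r ≤ t ∧ v 0 = 0 ∧ v r = a ∧ (∀ j ≤ r, v j ≤ a) ∧ Pth ω v 0 r}
  let B : Set Om := {ω | ∃ (r : ℕ) (v : ℕ → ℤ), r ≤ t ∧ v r = a ∧ v t = x ∧ (∀ j, r ≤ j → j ≤ t → a ≤ v j) ∧ Pth ω v r t}
  have dA : Dep G A := by
    rintro ω ω' h ⟨r, v, h1, h2, h3, h4, h5⟩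
    refine ⟨r, v, h1, h2, h3, h4, h5.transfer h fun j e a1 b1 c1 => ⟨h4 j b1.le, ?_⟩⟩
    simp only
    rw [← c1]; exact h4 _ b1
  have dB : Dep Gᶜ B := by
    rintro ω ω' h ⟨r, v, h1, h2, h3, h4, h5⟩
    refine ⟨r, v, h1, h2, h3, h4, h5.transfer h fun j e a1 b1 c1 => ?_⟩
    rintro ⟨g1, g2⟩
    simp only at g1 g2
    have e1 := h4 j a1 b1.le
    have e2 := h4 (j+1) (by omega) b1
    rcases stp_cases e with h' | h' <;> rw [h'] at c1 g2 <;> omega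
  have fA : FinDep A := by
    have : Dep (GB t 0 t) A := by
      rintro ω ω' h ⟨r, v, h1, h2, h3, h4, h5⟩
      refine ⟨r, v, h1, h2, h3, h4, h5.transfer h fun j e a1 b1 c1 => ⟨?_, by simp, by simp; omega⟩⟩
      have := (h5.bound le_rfl a1 b1.le).1
      simp only
      rw [abs_le] at *; push_cast at this; omega
    exact this.fin
  have fB : FinDep B := by
    have : Dep (GB (|x| + 2 * t) 0 t) B := by
      rintro ω ω' h ⟨r, v, h1, h2, h3, h4, h5⟩
      refine ⟨r, v, h1, h2, h3, h4, h5.transfer h fun j e a1 b1 c1 => ⟨?_, by simp, by simp; omega⟩⟩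
      have := (h5.bound a1 b1.le le_rfl).1
      simp only
      rcases abs_cases (v j) with ⟨u, _⟩ | ⟨u, _⟩ <;> rcases abs_cases x with ⟨u2, _⟩ | ⟨u2, _⟩ <;>
        rw [abs_le] at this <;> omega
    exact this.fin
  have hsub : Ta x t ⊆ A ∩ B := by
    rintro ω ⟨h0, v, hv0, rfl, hv⟩
    obtain ⟨j0, p1, p2, p3⟩ := hv.ivt (x := a) h0 (by omega) hax
    constructor
    · have hex : ∃ j, v j = a := ⟨j0, p3⟩
      have hle : Nat.find hex ≤ t := (Nat.find_min' hex p3).trans p2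
      refine ⟨Nat.find hex, v, hle, hv0, Nat.find_spec hex, fun j hj => ?_, hv.mono le_rfl hle⟩
      by_contra hcon
      obtain ⟨i, i1, i2, i3⟩ := (hv.mono le_rfl (hj.trans hle)).ivt (x := a) (Nat.zero_le j) (by omega) (by omega)
      have := Nat.find_min' hex i3
      have : i = j := by omega
      subst this; omega
    · have hs : v (Nat.findGreatest (fun j => v j = a) t) = a := Nat.findGreatest_spec (P := fun j => v j = a) p2 p3
      have hle := Nat.findGreatest_le (P := fun j => v j = a) t
      refine ⟨_, v, hle, hs, rfl, fun j hj1 hj2 => ?_, hv.mono (Nat.zero_le _) le_rfl⟩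
      by_contra hcon
      obtain ⟨i, i1, i2, i3⟩ := (hv.mono (Nat.zero_le j) le_rfl).ivt (x := a) hj2 (by omega) hax
      have := Nat.le_findGreatest (P := fun j => v j = a) i2 i3
      have : i = j := by omega
      subst this; omega
  have hA : Pr q A ≤ NN q t a := by
    refine pr_mono ?_
    rintro ω ⟨r, v, h1, h2, h3, h4, h5⟩
    exact ⟨r, h1, Nat.zero_le r, v, h2, h3, h5⟩
  have hB : Pr q B ≤ NN q t (x - a) := by
    rw [← pr_inv q (prf_inj x t) fB]
    refine pr_mono ?_
    rintro ω ⟨r, v, h1, h2, h3, h4, h5⟩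
    have := conn_prf (ω := ω) (x := x) ⟨h1, v, h2, h3, h5⟩ le_rfl
    exact ⟨t - r, by omega, by simpa using this⟩
  have h1 : ta q t x ≤ Pr q A * Pr q B := by
    rw [← indep hq G fA fB dA dB]; exact pr_mono hsub
  exact h1.trans (mul_le_mul hA hB (pr_nonneg _ _) (NN_nonneg _ _ _))

lemma ta_le_sq {q : ℝ} (hq : q ∈ Icc (0:ℝ) 1) (t : ℕ) {x : ℤ} (hx : 0 ≤ x) :
    ta q t x ≤ NN q t (x / 2) ^ 2 := by
  have h1 := ta_le hq t (x := x) (a := x / 2) (by omega) (by omega)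
  have h2 := NN_anti hq t (x := x / 2) (y := x - x / 2) (by omega) (by omega)
  rw [sq]
  exact h1.trans (mul_le_mul_of_nonneg_left h2 (NN_nonneg _ _ _))


/-! ### Translation to the simplified model -/

lemma connected_iff (ω : Config 1) (x : ℤ) (y : Fin 1 → ℤ) (s t : ℕ) :
    Connected ω (fun _ => x) s y t ↔ Conn (fun b => ω (iot b)) x s (y 0) t := by
  constructor
  · rintro (⟨h1, h2, -⟩ | ⟨hst, v, h1, h2, -, h3⟩)
    · subst h2; subst h1; exact Conn.refl _ _ _
    · refine ⟨hst.le, fun j => v j 0, by simp [h1], by simp [h2], fun j hj1 hj2 => ?_⟩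
      obtain ⟨h4, h5⟩ := h3 j hj1 hj2
      simp only [norm1, Finset.univ_unique, Fin.default_eq_zero, Finset.sum_singleton, Pi.sub_apply] at h4
      have h6 : ∃ e, v (j+1) 0 = v j 0 + stp e := by
        rcases abs_eq (by norm_num : (0:ℤ) ≤ 1) |>.1 h4 with h | h
        · exact ⟨true, by simp [stp]; omega⟩
        · exact ⟨false, by simp [stp]; omega⟩
      obtain ⟨e, he⟩ := h6
      refine ⟨e, he, ?_⟩
      rw [← h5]
      change ω (iot (v j 0, j, e)) = _
      congr 1
      unfold iot
      refine Prod.ext (Prod.ext ?_ rfl) ?_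
      · funext i; fin_cases i; rfl
      · funext i; fin_cases i; simp [he]
  · rintro ⟨hst, v, h1, h2, h3⟩
    rcases hst.eq_or_lt with rfl | hlt
    · refine Or.inl ⟨?_, rfl, trivial⟩
      funext i; fin_cases i; simp; omega
    · refine Or.inr ⟨hlt, fun j _ => v j, by simp [h1], ?_, fun _ _ _ => trivial, fun j hj1 hj2 => ?_⟩
      · funext i; fin_cases i; simp [h2]
      · obtain ⟨e, he, ho⟩ := h3 j hj1 hj2
        refine ⟨?_, ?_⟩
        · simp only [norm1, Finset.univ_unique, Fin.default_eq_zero, Finset.sum_singleton, Pi.sub_apply]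
          rcases stp_cases e with h | h <;> rw [he, h] <;> simp
        · rw [← ho]; simp only [iot, he]

lemma P_pre (q : ℝ) {A : Set Om} (fA : FinDep A) :
    (P 1 q {ω | (fun b => ω (iot b)) ∈ A}).toReal = Pr q A := by
  unfold Pr
  rw [measureReal_def, ← map_config, Measure.map_apply (by fun_prop) fA.meas]
  rfl

lemma theta_eq (q : ℝ) (t : ℕ) : theta 1 q t = th q t := by
  unfold theta th
  rw [← P_pre q (Th_fin t)]
  congr 2
  ext ω
  simp only [Th, mem_ofPred_eq]
  constructor
  · rintro ⟨y, h⟩; exact ⟨y 0, (connected_iff ω 0 y 0 t).1 h⟩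
  · rintro ⟨y, h⟩; exact ⟨fun _ => y, (connected_iff ω 0 (fun _ => y) 0 t).2 h⟩

lemma tau_eq (q : ℝ) (x : Fin 1 → ℤ) (t : ℕ) : tau 1 q x t = ta q t (x 0) := by
  unfold tau ta
  rw [← P_pre q (Ta_fin (x 0) t)]
  congr 2
  ext ω
  simp only [Ta, mem_ofPred_eq]
  exact connected_iff ω 0 x 0 t

lemma th_one (t : ℕ) : th 1 t = 1 := by
  refine pr_one (Th_fin t) ⟨t, zero_le, fun j => j, by simp, by simp, fun j h1 h2 => ⟨true, by simp [stp], rfl⟩⟩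

lemma pc_mem : pc 1 ∈ Icc (0:ℝ) 1 := by
  have hne : (1:ℝ) ∈ {p ∈ Set.Icc (0 : ℝ) 1 | 0 < ⨅ t : ℕ, theta 1 p t} := by
    refine ⟨⟨by norm_num, le_rfl⟩, ?_⟩
    simp [theta_eq, th_one]
  exact ⟨le_csInf ⟨1, hne⟩ fun x hx => hx.1.1, csInf_le ⟨0, fun x hx => hx.1.1⟩ hne⟩

lemma exists_super {ε : ℝ} (hε : 0 < ε) : ∃ q ∈ Icc (0:ℝ) 1, pc 1 ≤ q ∧ q < pc 1 + ε ∧ 0 < ⨅ t : ℕ, th q t := by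
  have hne : (1:ℝ) ∈ {p ∈ Set.Icc (0 : ℝ) 1 | 0 < ⨅ t : ℕ, theta 1 p t} := by
    refine ⟨⟨by norm_num, le_rfl⟩, ?_⟩
    simp [theta_eq, th_one]
  have h : sInf {p ∈ Set.Icc (0 : ℝ) 1 | 0 < ⨅ t : ℕ, theta 1 p t} < pc 1 + ε := by
    change pc 1 < _
    linarith
  obtain ⟨q, hq, hlt⟩ := exists_lt_of_csInf_lt ⟨1, hne⟩ h
  refine ⟨q, hq.1, csInf_le ⟨0, fun x hx => hx.1.1⟩ hq, hlt, ?_⟩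
  have := hq.2
  simpa only [theta_eq] using this

/-! ### Exponential decay below criticality -/

lemma lap (N : ℕ) (p y : ℕ → ℝ) (M : ℝ) (hM : 0 < M) (hp : ∀ i ∈ Finset.range N, 0 ≤ p i)
    (h1 : ∑ i ∈ Finset.range N, p i = 1) (hy : ∀ i ∈ Finset.range N, |y i| ≤ M)
    (hneg : ∑ i ∈ Finset.range N, p i * y i < 0) :
    ∃ l : ℝ, 0 < l ∧ ∑ i ∈ Finset.range N, p i * Real.exp (l * y i) < 1 := by
  set μ := ∑ i ∈ Finset.range N, p i * y i with hμ
  have hμM : -M ≤ μ := by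
    have : ∑ i ∈ Finset.range N, p i * (-M) ≤ μ := by
      refine Finset.sum_le_sum fun i hi => ?_
      exact mul_le_mul_of_nonneg_left (abs_le.1 (hy i hi)).1 (hp i hi)
    rw [← Finset.sum_mul, h1] at this
    linarith
  refine ⟨-μ / (2 * M ^ 2), by apply div_pos <;> [linarith; positivity], ?_⟩
  set l := -μ / (2 * M ^ 2) with hl
  have hl0 : 0 < l := by apply div_pos <;> [linarith; positivity]
  have hlM : l * (2 * M ^ 2) = -μ := by rw [hl]; field_simp
  have hlM2 : l * M ≤ 1 := by
    have : l * M * (2 * M) ≤ 1 * (2 * M) := by nlinarith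
    exact le_of_mul_le_mul_right this (by linarith)
  have key : ∑ i ∈ Finset.range N, p i * Real.exp (l * y i) ≤
      ∑ i ∈ Finset.range N, (p i + l * (p i * y i) + p i * (l * M) ^ 2) := by
    refine Finset.sum_le_sum fun i hi => ?_
    have h2 : |l * y i| ≤ l * M := by
      rw [abs_mul, abs_of_pos hl0]; exact mul_le_mul_of_nonneg_left (hy i hi) hl0.le
    have h3 := (abs_le.1 (Real.abs_exp_sub_one_sub_id_le (h2.trans hlM2))).2
    have h4 : (l * y i) ^ 2 ≤ (l * M) ^ 2 := by
      rw [← sq_abs (l * y i)]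
      exact pow_le_pow_left₀ (abs_nonneg _) h2 2
    have h5 : Real.exp (l * y i) ≤ 1 + l * y i + (l * M) ^ 2 := by linarith
    calc p i * Real.exp (l * y i) ≤ p i * (1 + l * y i + (l * M) ^ 2) :=
          mul_le_mul_of_nonneg_left h5 (hp i hi)
      _ = _ := by ring
  refine key.trans_lt ?_
  rw [Finset.sum_add_distrib, Finset.sum_add_distrib, ← Finset.mul_sum, ← Finset.sum_mul, h1, ← hμ]
  nlinarith

/-- tail weights -/
noncomputable def aa (q : ℝ) (s k i : ℕ) : ℝ := if i = 0 then 1 else DD q s (-(k:ℤ) + i)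

lemma aa_sum (a : ℕ → ℝ) (k : ℝ) (n : ℕ) : ∑ i ∈ Finset.range n, (a i - a (i+1)) * (-k + i) =
    -k * a 0 + ∑ i ∈ Finset.range n, a (i+1) - (n - k) * a n := by
  induction n with
  | zero => simp
  | succ n ih => rw [Finset.sum_range_succ, Finset.sum_range_succ, ih]; push_cast; ring

/-- the events that the rightmost point is at a given level -/
def EL (s k i : ℕ) : Set Om := if i = 0 then univ else HL 0 0 (-(k:ℤ) + i) s

lemma EL_dep (s k i : ℕ) : ∃ M, Dep (GB M 0 s) (EL s k i) := by
  unfold EL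
  split_ifs with h
  · exact ⟨0, fun _ _ _ _ => trivial⟩
  · exact ⟨_, HL_dep _ _ _ _⟩

lemma EL_fin (s k i : ℕ) : FinDep (EL s k i) := by
  obtain ⟨M, h⟩ := EL_dep s k i
  exact h.fin

lemma pr_EL (q : ℝ) (s k i : ℕ) : Pr q (EL s k i) = aa q s k i := by
  unfold EL aa
  split_ifs with h
  · exact pr_univ q
  · rfl

lemma EL_sub (s k i : ℕ) : EL s k (i+1) ⊆ EL s k i := by
  unfold EL
  by_cases h : i = 0
  · simp [h]
  · rw [if_neg h, if_neg (by omega)]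
    rintro ω ⟨z, y, h1, h2, h3, h4⟩
    exact ⟨z, y, h1, h2, by push_cast at h3; omega, h4⟩

lemma pr_EL_diff (q : ℝ) (s k i : ℕ) : Pr q (EL s k i ∩ (EL s k (i+1))ᶜ) = aa q s k i - aa q s k (i+1) := by
  have := pr_inter_add (q := q) (A := EL s k i) (EL_fin s k (i+1))
  rw [Set.inter_eq_right.2 (EL_sub s k i), pr_EL, pr_EL] at this
  linarith

lemma DD_step {q : ℝ} (hq : q ∈ Icc (0:ℝ) 1) (s k n : ℕ) (hk : (2:ℤ) ∣ (k:ℤ) - s) (x : ℤ) :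
    DD q (s + n) x ≤ ∑ i ∈ Finset.range (s + k + 1), (aa q s k i - aa q s k (i+1)) * DD q n (x - (-(k:ℤ) + i)) := by
  have h0 : HL 0 0 x (s + n) ⊆ ⋃ i ∈ Finset.range (s + k + 1),
      ((EL s k i ∩ (EL s k (i+1))ᶜ) ∩ HL (-(k:ℤ) + i) s x (s + n)) := by
    rintro ω ⟨z, y, h1, h2, h3, h4⟩
    obtain ⟨w, hw1, hw2⟩ := h4.split (r := s) (by omega) (by omega)
    -- least `i` with `ω ∉ EL (i+1)`
    have hex : ∃ i, ω ∉ EL s k (i+1) := by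
      refine ⟨s + k, ?_⟩
      rw [EL, if_neg (by omega)]
      rintro ⟨z, y, h1, h2, h3, h4⟩
      have := (abs_le.1 h4.bound.1).2
      push_cast at h3 this
      omega
    set i := Nat.find hex with hi
    have hi1 : ω ∉ EL s k (i+1) := Nat.find_spec hex
    have hi2 : ω ∈ EL s k i := by
      rcases Nat.eq_zero_or_pos i with h | h
      · rw [h]; simp [EL]
      · have := Nat.find_min hex (m := i - 1) (by omega)
        rw [show i - 1 + 1 = i by omega] at this
        simpa using this
    have hi3 : i ≤ s + k := by
      refine Nat.find_min' hex ?_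
      rw [EL, if_neg (by omega)]
      rintro ⟨z, y, h1, h2, h3, h4⟩
      have := (abs_le.1 h4.bound.1).2
      push_cast at h3 this
      omega
    rw [mem_iUnion₂]
    refine ⟨i, by simp; omega, ⟨hi2, hi1⟩, w, y, ?_, ?_, h3, hw2⟩
    · by_contra hlt
      apply hi1
      rw [EL, if_neg (by omega)]
      exact ⟨z, w, h1, h2, by push_cast; omega, hw1⟩
    · have hpw := hw1.bound.2
      rcases Nat.eq_zero_or_pos i with h | h
      · rw [h]; push_cast at *; omega
      · rw [EL, if_neg (by omega)] at hi2
        obtain ⟨z', y', g1, g2, g3, g4⟩ := hi2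
        have hpw' := g4.bound.2
        have : y' ≤ -(k:ℤ) + i := by
          by_contra hlt
          apply hi1
          rw [EL, if_neg (by omega)]
          exact ⟨z', y', g1, g2, by push_cast; omega, g4⟩
        push_cast at *
        omega
  have h1 := pr_mono (q := q) h0
  refine h1.trans ((measureReal_biUnion_finset_le _ _).trans (Finset.sum_le_sum fun i _ => ?_))
  have hfin : FinDep (EL s k i ∩ (EL s k (i+1))ᶜ) := (EL_fin s k i).inter (EL_fin s k (i+1)).compl
  have hdep : Dep (TB s) (EL s k i ∩ (EL s k (i+1))ᶜ) := by
    obtain ⟨M1, h1⟩ := EL_dep s k i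
    obtain ⟨M2, h2⟩ := EL_dep s k (i+1)
    exact (h1.mono (GB_TB _ _ _)).inter ((h2.mono (GB_TB _ _ _)).compl)
  have := indep hq (TB s) hfin (HL_fin (-(k:ℤ) + i) s x (s + n)) hdep ((HL_dep _ _ _ _).mono (GB_TBc _ _ _))
  rw [pr_EL_diff, pr_HL q _ (by omega)] at this
  rw [show s + n - s = n by omega] at this
  exact this.le

lemma aa_anti (q : ℝ) (s k i : ℕ) : aa q s k (i+1) ≤ aa q s k i := by
  rw [← pr_EL, ← pr_EL]; exact pr_mono (EL_sub s k i)

lemma aa_last (q : ℝ) (s k : ℕ) : aa q s k (s + k + 1) = 0 := by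
  rw [aa, if_neg (by omega)]
  exact DD_zero q s (by push_cast; omega)

lemma decay {q : ℝ} (hq : q ∈ Icc (0:ℝ) 1) (s k : ℕ) (hk : (2:ℤ) ∣ (k:ℤ) - s)
    (h : ∑ i ∈ Finset.range (s + k), DD q s (-(k:ℤ) + 1 + i) < k) :
    ∃ φ : ℝ, 0 ≤ φ ∧ φ < 1 ∧ ∀ n : ℕ, th q (n * s) ≤ 2 * φ ^ n := by
  set a := aa q s k with ha
  have ha0 : a 0 = 1 := by simp [ha, aa]
  have hlast : a (s + k + 1) = 0 := aa_last q s k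
  obtain ⟨l, hl, hlt⟩ := lap (s + k + 1) (fun i => a i - a (i+1)) (fun i => -(k:ℝ) + i) (s + k + 1) (by positivity)
    (fun i _ => by have := aa_anti q s k i; simp only [sub_nonneg]; exact this)
    (by rw [Finset.sum_range_sub', hlast, ha0]; ring)
    (fun i hi => by
      have : i ≤ s + k := by have := Finset.mem_range.1 hi; omega
      have : (i:ℝ) ≤ s + k := by exact_mod_cast this
      have h2 : (0:ℝ) ≤ i := by positivity
      have h3 : (0:ℝ) ≤ k := by positivity
      have h4 : (0:ℝ) ≤ s := by positivity
      rw [abs_le]; constructor <;> linarith)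
    (by
      rw [aa_sum, hlast, Finset.sum_range_succ, hlast, ha0]
      have : ∑ i ∈ Finset.range (s + k), a (i+1) = ∑ i ∈ Finset.range (s + k), DD q s (-(k:ℤ) + 1 + i) := by
        refine Finset.sum_congr rfl fun i _ => ?_
        rw [ha, aa, if_neg (by omega)]
        congr 1; push_cast; ring
      rw [this]; linarith)
  set φ := ∑ i ∈ Finset.range (s + k + 1), (a i - a (i+1)) * Real.exp (l * (-(k:ℝ) + i)) with hφ
  have hφ0 : 0 ≤ φ := Finset.sum_nonneg fun i _ =>
    mul_nonneg (sub_nonneg.2 (aa_anti q s k i)) (Real.exp_pos _).le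
  refine ⟨φ, hφ0, hlt, ?_⟩
  have main : ∀ n : ℕ, ∀ x : ℤ, DD q (n * s) x ≤ φ ^ n * Real.exp (-l * x) := by
    intro n
    induction n with
    | zero =>
      intro x
      simp only [zero_mul, pow_zero, one_mul]
      rcases lt_or_ge 0 x with hx | hx
      · rw [DD_zero q 0 (by simpa using hx)]; exact (Real.exp_pos _).le
      · refine (DD_le_one _ _ _).trans (Real.one_le_exp ?_)
        have : (x:ℝ) ≤ 0 := by exact_mod_cast hx
        nlinarith
    | succ n ih =>
      intro x
      rw [show (n+1) * s = s + n * s by ring]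
      refine (DD_step hq s k (n * s) hk x).trans ?_
      calc _ ≤ ∑ i ∈ Finset.range (s + k + 1), (a i - a (i+1)) *
            (φ ^ n * Real.exp (-l * ((x - (-(k:ℤ) + i) : ℤ) : ℝ))) :=
            Finset.sum_le_sum fun i _ => mul_le_mul_of_nonneg_left (ih _) (sub_nonneg.2 (aa_anti q s k i))
        _ = ∑ i ∈ Finset.range (s + k + 1), (φ ^ n * Real.exp (-l * x)) *
            ((a i - a (i+1)) * Real.exp (l * (-(k:ℝ) + i))) := by
            refine Finset.sum_congr rfl fun i _ => ?_
            have : Real.exp (-l * ((x - (-(k:ℤ) + i) : ℤ) : ℝ)) =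
                Real.exp (-l * x) * Real.exp (l * (-(k:ℝ) + i)) := by
              rw [← Real.exp_add]; congr 1; push_cast; ring
            rw [this]; ring
        _ = φ ^ (n+1) * Real.exp (-l * x) := by
            rw [← Finset.mul_sum, ← hφ]; ring
  intro n
  have h1 := main n 0
  have h2 := th_le q (n * s)
  have h3 := RR_le_DD q (n * s) 0
  simp at h1
  linarith

lemma crit (s k : ℕ) (hk : (2:ℤ) ∣ (k:ℤ) - s) :
    (k:ℝ) ≤ ∑ i ∈ Finset.range (s + k), DD (pc 1) s (-(k:ℤ) + 1 + i) := by
  rcases Nat.eq_zero_or_pos s with rfl | hs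
  · have : ∀ i ∈ Finset.range (0 + k), DD (pc 1) 0 (-(k:ℤ) + 1 + i) = 1 := by
      intro i hi
      have hi' := Finset.mem_range.1 hi
      rw [DD, ← pr_univ (pc 1)]
      congr 1
      rw [Set.eq_univ_iff_forall]
      intro ω
      exact ⟨0, 0, le_rfl, by simp, by omega, Conn.refl _ _ _⟩
    rw [Finset.sum_congr rfl this]
    simp
  · by_contra hcon
    push Not at hcon
    have hc : ContinuousOn (fun q => ∑ i ∈ Finset.range (s + k), DD q s (-(k:ℤ) + 1 + i)) (Icc 0 1) :=
      continuousOn_finsetSum _ fun i _ => pr_cont (HL_fin _ _ _ _)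
    have h1 := (hc (pc 1) pc_mem).eventually (gt_mem_nhds hcon)
    rw [eventually_nhdsWithin_iff, Metric.eventually_nhds_iff] at h1
    obtain ⟨ε, hε, h2⟩ := h1
    obtain ⟨q, hq, hq1, hq2, hpos⟩ := exists_super hε
    have h3 := h2 (y := q) (by rw [Real.dist_eq, abs_lt]; constructor <;> linarith) hq
    obtain ⟨φ, h0, h1, hd⟩ := decay hq s k hk h3
    have h4 : Tendsto (fun n : ℕ => 2 * φ ^ n) atTop (𝓝 (2 * 0)) :=
      (tendsto_pow_atTop_nhds_zero_of_lt_one h0 h1).const_mul 2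
    rw [mul_zero] at h4
    have h5 : (⨅ t : ℕ, th q t) ≤ 0 := by
      refine ge_of_tendsto' h4 fun n => (ciInf_le ?_ (n * s)).trans (hd n)
      exact ⟨0, by rintro _ ⟨t, rfl⟩; exact th_nonneg q t⟩
    linarith

/-! ### Final estimates -/

lemma geo_sum (M : ℕ) (hM : 1 ≤ M) (n : ℕ) : ∑ y ∈ Finset.range n, (1/2:ℝ) ^ (y / M) ≤ 2 * M := by
  have key : ∀ j : ℕ, ∑ y ∈ Finset.range (M * j), (1/2:ℝ) ^ (y / M) = 2 * M * (1 - (1/2:ℝ) ^ j) := by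
    intro j
    induction j with
    | zero => simp
    | succ j ih =>
      rw [Nat.mul_succ, Finset.sum_range_add, ih]
      have : ∀ y ∈ Finset.range M, (1/2:ℝ) ^ ((M * j + y) / M) = (1/2:ℝ) ^ j := by
        intro y hy
        have hy' := Finset.mem_range.1 hy
        rw [Nat.mul_add_div (by omega), Nat.div_eq_of_lt hy', add_zero]
      rw [Finset.sum_congr rfl this]
      simp only [Finset.sum_const, Finset.card_range, nsmul_eq_mul]
      rw [pow_succ]; ring
  have h1 : ∑ y ∈ Finset.range n, (1/2:ℝ) ^ (y / M) ≤ ∑ y ∈ Finset.range (M * n), (1/2:ℝ) ^ (y / M) := by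
    refine Finset.sum_le_sum_of_subset_of_nonneg ?_ fun _ _ _ => by positivity
    exact Finset.range_subset_range.2 (Nat.le_mul_of_pos_left n hM)
  rw [key] at h1
  have : (0:ℝ) ≤ 2 * M * (1/2:ℝ) ^ n := by positivity
  linarith

lemma ff_pow {q : ℝ} (hq : q ∈ Icc (0:ℝ) 1) (t k : ℕ) (h : ff q t (8 * k) ≤ 1/2) (j : ℕ) :
    ff q t ((8 * k * j : ℕ) : ℤ) ≤ (1/2) ^ j := by
  induction j with
  | zero => simpa using ff_le_one _ _ _
  | succ j ih =>
    have h1 := ff_mul hq t (x := ((8 * k * j : ℕ) : ℤ)) (y := 8 * k) (by positivity) (by positivity)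
    rw [show ((8 * k * (j+1) : ℕ) : ℤ) = ((8 * k * j : ℕ) : ℤ) + 8 * k by push_cast; ring]
    refine h1.trans ?_
    rw [pow_succ]
    exact mul_le_mul ih h (ff_nonneg _ _ _) (by positivity)

lemma ff_geo {q : ℝ} (hq : q ∈ Icc (0:ℝ) 1) (t k : ℕ) (h : ff q t (8 * k) ≤ 1/2) (y : ℕ) :
    ff q t (y : ℤ) ≤ (1/2) ^ (y / (8 * k)) := by
  refine le_trans ?_ (ff_pow hq t k h (y / (8 * k)))
  refine ff_anti hq t (by positivity) ?_
  exact_mod_cast Nat.mul_div_le y (8 * k)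

lemma low_DD (t k : ℕ) (hk : 1 ≤ k) (h : ff (pc 1) t (8 * k) ≤ 1/2) (s : ℕ) (hs : s ≤ t) :
    1/84 ≤ DD (pc 1) s (-(k:ℤ)) := by
  obtain ⟨k', h1, h2, h3⟩ : ∃ k' : ℕ, k ≤ k' ∧ k' ≤ k + 1 ∧ (2:ℤ) ∣ (k':ℤ) - s := by
    by_cases hp : (2:ℤ) ∣ (k:ℤ) - s
    · exact ⟨k, le_rfl, by omega, hp⟩
    · exact ⟨k + 1, by omega, le_rfl, by push_cast; omega⟩
  have hc := crit s k' h3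
  set d := DD (pc 1) s (-(k:ℤ)) with hd
  have hd0 : 0 ≤ d := DD_nonneg _ _ _
  have e1 : ∑ i ∈ Finset.range (s + k'), DD (pc 1) s (-(k':ℤ) + 1 + i) ≤
      ∑ i ∈ Finset.range ((40 * k + k') + s), DD (pc 1) s (-(k':ℤ) + 1 + i) :=
    Finset.sum_le_sum_of_subset_of_nonneg (Finset.range_subset_range.2 (by omega)) fun _ _ _ => DD_nonneg _ _ _
  rw [Finset.sum_range_add _ (40 * k + k') s] at e1
  have e2 : ∑ i ∈ Finset.range (40 * k + k'), DD (pc 1) s (-(k':ℤ) + 1 + i) ≤ (40 * k + k' : ℕ) * d := by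
    have := Finset.sum_le_card_nsmul (Finset.range (40 * k + k')) (fun i : ℕ => DD (pc 1) s (-(k':ℤ) + 1 + i)) d
      (fun i _ => DD_anti _ _ (by omega))
    simpa using this
  have e3 : ∑ i ∈ Finset.range s, DD (pc 1) s (-(k':ℤ) + 1 + ((40 * k + k' + i : ℕ) : ℤ)) ≤
      ∑ i ∈ Finset.range s, (1/32:ℝ) * (1/2) ^ (i / (8 * k)) := by
    refine Finset.sum_le_sum fun i _ => ?_
    have a1 : DD (pc 1) s (-(k':ℤ) + 1 + ((40 * k + k' + i : ℕ) : ℤ)) ≤ ff (pc 1) t ((i + 8 * k * 5 : ℕ) : ℤ) :=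
      (DD_anti _ _ (by push_cast; omega)).trans ((DD_le_ff _ _ (by positivity)).trans (ff_mono _ hs _))
    have a2 := ff_geo pc_mem t k h (i + 8 * k * 5)
    rw [Nat.add_mul_div_left _ _ (by omega), pow_add] at a2
    have : ((1:ℝ)/2) ^ 5 = 1/32 := by norm_num
    rw [this] at a2
    linarith
  rw [← Finset.mul_sum] at e3
  have e4 := geo_sum (8 * k) (by omega) s
  have h1' : (k:ℝ) ≤ k' := by exact_mod_cast h1
  have h2' : (k':ℝ) ≤ k + 1 := by exact_mod_cast h2
  have hk' : (1:ℝ) ≤ k := by exact_mod_cast hk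
  push_cast at e2 e4
  have e5 : (40 * (k:ℝ) + k') * d ≤ 42 * k * d := mul_le_mul_of_nonneg_right (by linarith) hd0
  have e6 : (k:ℝ) * (1/84) ≤ k * d := by linarith
  exact le_of_mul_le_mul_left e6 (by linarith)

/-- expected size as a finite sum -/
noncomputable def ch (q : ℝ) (t : ℕ) : ℝ := ∑ x ∈ Finset.Icc (-(t:ℤ)) t, ta q t x

lemma ch_nonneg (q : ℝ) (t : ℕ) : 0 ≤ ch q t := Finset.sum_nonneg fun _ _ => ta_nonneg _ _ _

lemma th_le_ch (q : ℝ) (t : ℕ) : th q t ≤ ch q t := by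
  have h0 : Th t ⊆ ⋃ x ∈ Finset.Icc (-(t:ℤ)) t, Ta x t := by
    rintro ω ⟨y, h⟩
    rw [mem_iUnion₂]
    refine ⟨y, ?_, h⟩
    have := abs_le.1 h.bound.1
    rw [Finset.mem_Icc]
    push_cast at this
    omega
  exact (pr_mono (q := q) h0).trans (measureReal_biUnion_finset_le _ _)

lemma ch_ge_of_DD {q : ℝ} (hq : q ∈ Icc (0:ℝ) 1) (t k : ℕ) (δ : ℝ) (hδ : 0 < δ) (h : δ ≤ DD q t k) :
    k * (th q t ^ 2 * δ / 4) ≤ ch q t := by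
  have hkt : k ≤ t := by
    by_contra hlt
    rw [DD_zero q t (by omega)] at h
    linarith
  let e : ℕ := t % 2
  have he : e = t % 2 := rfl
  let J : Finset ℤ := (Finset.range ((k+1)/2)).image (fun j : ℕ => 2 * (j:ℤ) + e)
  have hJ : J ⊆ Finset.Icc (-(t:ℤ)) t := by
    intro x hx
    obtain ⟨j, hj, rfl⟩ := Finset.mem_image.1 hx
    have := Finset.mem_range.1 hj
    rw [Finset.mem_Icc]
    omega
  have h1 : ∑ x ∈ J, ta q t x ≤ ch q t :=
    Finset.sum_le_sum_of_subset_of_nonneg hJ fun _ _ _ => ta_nonneg _ _ _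
  have h2 : J.card = (k+1)/2 := by
    rw [Finset.card_image_of_injective, Finset.card_range]
    intro a b hab
    simp only at hab
    omega
  have h3 := Finset.card_nsmul_le_sum J (fun x => ta q t x) (th q t ^ 2 / 2 * δ) (by
    intro x hx
    obtain ⟨j, hj, rfl⟩ := Finset.mem_image.1 hx
    have := Finset.mem_range.1 hj
    refine le_trans ?_ (ta_ge hq t (by omega) (by omega))
    refine mul_le_mul_of_nonneg_left (h.trans (DD_anti _ _ (by omega))) (by positivity))
  rw [h2, nsmul_eq_mul] at h3
  have h4 : (k:ℝ) / 2 ≤ (((k+1)/2 : ℕ) : ℝ) := by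
    rw [div_le_iff₀ (by norm_num)]
    have : k ≤ (k+1)/2 * 2 := by omega
    exact_mod_cast this
  have h5 : (k:ℝ) / 2 * (th q t ^ 2 / 2 * δ) ≤ (((k+1)/2 : ℕ) : ℝ) * (th q t ^ 2 / 2 * δ) :=
    mul_le_mul_of_nonneg_right h4 (by positivity)
  calc _ = (k:ℝ) / 2 * (th q t ^ 2 / 2 * δ) := by ring
    _ ≤ _ := h5.trans (h3.trans h1)

/-- choice of the scale -/
lemma scale (t : ℕ) : ∃ k : ℕ, 1 ≤ k ∧ ff (pc 1) t (8 * k) ≤ 1/2 ∧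
    (k:ℝ) * th (pc 1) t ^ 2 * (1/112896) ≤ ch (pc 1) t := by
  have hex : ∃ n : ℕ, ff (pc 1) t (4 * n) < 1/2 := by
    refine ⟨t + 1, ?_⟩
    rw [ff_zero]
    · norm_num
    · push_cast; omega
  have hspec := Nat.find_spec hex
  set n := Nat.find hex with hn
  have hth0 := th_nonneg (pc 1) t
  have hth1 := th_le_one (pc 1) t
  by_cases h1 : n ≤ 1
  · refine ⟨1, le_rfl, ?_, ?_⟩
    · refine le_trans (ff_anti pc_mem t (x := 4 * n) (by positivity) ?_) hspec.le
      push_cast; omega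
    · have := th_le_ch (pc 1) t
      push_cast
      nlinarith
  · have hk : 1 ≤ n - 1 := by omega
    have hle : ff (pc 1) t (8 * (n - 1 : ℕ)) ≤ 1/2 := by
      refine le_trans (ff_anti pc_mem t (x := 4 * n) (by positivity) ?_) hspec.le
      omega
    refine ⟨n - 1, hk, hle, ?_⟩
    have hge := Nat.find_min hex (m := n - 1) (by omega)
    push Not at hge
    have hlow := low_DD t (n - 1) hk hle
    have hp := main_push pc_mem t (k := ((n - 1 : ℕ) : ℤ)) (by positivity) (c := 1/84) hlow
    have hD : 1/84 ≤ DD (pc 1) t (-((n-1:ℕ):ℤ)) := hlow t le_rfl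
    have h3 : (1/2:ℝ) * (1/84) ≤ ff (pc 1) t (4 * ((n - 1 : ℕ) : ℤ)) * DD (pc 1) t (-((n-1:ℕ):ℤ)) :=
      mul_le_mul hge hD (by norm_num) (ff_nonneg _ _ _)
    have h4 := ch_ge_of_DD pc_mem t (n - 1) (1/28224) (by norm_num) (by linarith)
    linarith

lemma NN_scale (t k : ℕ) (hk : 1 ≤ k) (h : ff (pc 1) t (8 * k) ≤ 1/2) (j : ℕ) (hj : 36 ≤ j) :
    NN (pc 1) t ((8 * k * j : ℕ) : ℤ) ≤ 168 * 2 ^ 36 * th (pc 1) t * (1/2) ^ j := by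
  have h1 := NN_VV pc_mem t (n := ((8 * k * 9 : ℕ) : ℤ)) (by positivity)
  have h2 := VV_ge (pc 1) t (n := ((8 * k * 9 : ℕ) : ℤ)) (by positivity)
  have h3 : 1/84 ≤ DD (pc 1) t (-((8 * k * 9 : ℕ) : ℤ)) :=
    (low_DD t k hk h t le_rfl).trans (DD_anti _ _ (by push_cast; omega))
  have h4 := ff_pow pc_mem t k h 9
  have h5 : ff (pc 1) t (2 * ((8 * k * 9 : ℕ) : ℤ) + 1) ≤ ff (pc 1) t ((8 * k * 9 : ℕ) : ℤ) :=
    ff_anti pc_mem t (by positivity) (by push_cast; omega)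
  have h6 : ((1:ℝ)/2) ^ 9 = 1/512 := by norm_num
  rw [h6] at h4
  have h7 : 1/168 ≤ Pr (pc 1) (VV ((8 * k * 9 : ℕ) : ℤ) t) := by linarith
  have h8 : NN (pc 1) t ((8 * k * 36 : ℕ) : ℤ) ≤ 168 * th (pc 1) t := by
    have e : (4 * ((8 * k * 9 : ℕ) : ℤ)) = ((8 * k * 36 : ℕ) : ℤ) := by push_cast; ring
    rw [e] at h1
    have := mul_le_mul_of_nonneg_left h7 (NN_nonneg (pc 1) t ((8 * k * 36 : ℕ) : ℤ))
    linarith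
  obtain ⟨i, rfl⟩ := Nat.exists_eq_add_of_le hj
  have h9 := NN_mul pc_mem t (x := ((8 * k * 36 : ℕ) : ℤ)) (y := ((8 * k * i : ℕ) : ℤ)) (by positivity) (by positivity)
  rw [show ((8 * k * (36 + i) : ℕ) : ℤ) = ((8 * k * 36 : ℕ) : ℤ) + ((8 * k * i : ℕ) : ℤ) by push_cast; ring]
  refine h9.trans ?_
  refine (mul_le_mul h8 (ff_pow pc_mem t k h i) (ff_nonneg _ _ _) (by linarith [th_nonneg (pc 1) t])).trans (le_of_eq ?_)
  rw [pow_add]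
  ring

lemma sq_le_pow (j : ℕ) : ((1:ℝ) + j) ^ 2 ≤ 4 * 2 ^ j := by
  induction j with
  | zero => norm_num
  | succ j ih =>
    rcases Nat.lt_or_ge j 2 with h | h
    · interval_cases j <;> norm_num
    · have : (2:ℝ) ≤ j := by exact_mod_cast h
      rw [pow_succ 2 j]; push_cast
      nlinarith

lemma x_bound (t k : ℕ) (hk : 1 ≤ k) (h : ff (pc 1) t (8 * k) ≤ 1/2) (m : ℕ) :
    (m:ℝ) ^ 2 * ta (pc 1) t m ≤ (576 * k) ^ 2 * ta (pc 1) t m +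
      1024 * (168 * 2 ^ 36) ^ 2 * k ^ 2 * th (pc 1) t ^ 2 * (1/2) ^ (m / (16 * k)) := by
  have hta := ta_nonneg (pc 1) t m
  set j := m / (16 * k) with hj
  have hm : m < 16 * k * (j + 1) := Nat.lt_mul_div_succ m (by omega)
  by_cases h36 : j < 36
  · have h1 : (m:ℝ) ≤ 576 * k := by
      have : m ≤ 576 * k := by
        refine hm.le.trans ?_
        calc 16 * k * (j+1) ≤ 16 * k * 36 := Nat.mul_le_mul_left _ (by omega)
          _ = 576 * k := by ring
      exact_mod_cast this
    have h2 : (m:ℝ) ^ 2 ≤ (576 * k) ^ 2 := pow_le_pow_left₀ (by positivity) h1 2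
    have h3 := mul_le_mul_of_nonneg_right h2 hta
    have : (0:ℝ) ≤ 1024 * (168 * 2 ^ 36) ^ 2 * k ^ 2 * th (pc 1) t ^ 2 * (1/2) ^ j := by positivity
    linarith
  · have h1 : (m:ℝ) ≤ 16 * k * (1 + j) := by
      have : (m:ℝ) ≤ ((16 * k * (j+1) : ℕ) : ℝ) := by exact_mod_cast hm.le
      push_cast at this
      linarith
    have h2 : (m:ℝ) ^ 2 ≤ (16 * k * (1 + j)) ^ 2 := pow_le_pow_left₀ (by positivity) h1 2
    have h3 := ta_le_sq pc_mem t (x := (m:ℤ)) (by positivity)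
    have h4 : NN (pc 1) t ((m:ℤ)/2) ≤ 168 * 2 ^ 36 * th (pc 1) t * (1/2) ^ j := by
      refine le_trans (NN_anti pc_mem t (by positivity) ?_) (NN_scale t k hk h j (by omega))
      have h5 : 16 * k * j ≤ m := Nat.mul_div_le m (16 * k)
      have h6 : 8 * k * j ≤ m / 2 := by
        rw [Nat.le_div_iff_mul_le (by norm_num)]
        calc 8 * k * j * 2 = 16 * k * j := by ring
          _ ≤ m := h5
      exact_mod_cast h6
    have h5 : ta (pc 1) t m ≤ (168 * 2 ^ 36 * th (pc 1) t * (1/2) ^ j) ^ 2 :=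
      h3.trans (pow_le_pow_left₀ (NN_nonneg _ _ _) h4 2)
    have h6 : (m:ℝ) ^ 2 * ta (pc 1) t m ≤ (16 * k * (1 + j)) ^ 2 * (168 * 2 ^ 36 * th (pc 1) t * (1/2) ^ j) ^ 2 :=
      mul_le_mul h2 h5 hta (by positivity)
    have h7 := sq_le_pow j
    have h8 : (2:ℝ) ^ j * (1/2) ^ j = 1 := by rw [← mul_pow]; norm_num
    have h9 : ((1:ℝ) + j) ^ 2 * ((1/2) ^ j) ^ 2 ≤ 4 * (1/2) ^ j := by
      calc ((1:ℝ) + j) ^ 2 * ((1/2) ^ j) ^ 2 ≤ 4 * 2 ^ j * ((1/2) ^ j) ^ 2 :=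
            mul_le_mul_of_nonneg_right h7 (by positivity)
        _ = 4 * ((2:ℝ) ^ j * (1/2) ^ j) * (1/2) ^ j := by ring
        _ = _ := by rw [h8]; ring
    have h10 : (0:ℝ) ≤ 256 * (168 * 2 ^ 36) ^ 2 * k ^ 2 * th (pc 1) t ^ 2 := by positivity
    have h11 := mul_le_mul_of_nonneg_left h9 h10
    have h12 : (0:ℝ) ≤ (576 * k) ^ 2 * ta (pc 1) t m := by positivity
    have h13 : ((16:ℝ) * k * (1 + j)) ^ 2 * (168 * 2 ^ 36 * th (pc 1) t * (1/2) ^ j) ^ 2 =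
        256 * (168 * 2 ^ 36) ^ 2 * k ^ 2 * th (pc 1) t ^ 2 * (((1:ℝ) + j) ^ 2 * ((1/2) ^ j) ^ 2) := by ring
    have h14 : (256 * (168 * 2 ^ 36) ^ 2 * k ^ 2 * th (pc 1) t ^ 2 * (4 * (1/2) ^ j) : ℝ) =
      1024 * (168 * 2 ^ 36) ^ 2 * k ^ 2 * th (pc 1) t ^ 2 * (1/2) ^ j := by ring
    linarith

lemma abs_sum_le (t : ℕ) (g : ℕ → ℝ) (hg : ∀ n, 0 ≤ g n) :
    ∑ x ∈ Finset.Icc (-(t:ℤ)) t, g x.natAbs ≤ 2 * ∑ m ∈ Finset.range (t+1), g m := by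
  have h1 : Finset.Icc (-(t:ℤ)) t ⊆ (Finset.range (t+1)).image (fun m : ℕ => (m:ℤ)) ∪
      (Finset.range (t+1)).image (fun m : ℕ => -(m:ℤ)) := by
    intro x hx
    rw [Finset.mem_Icc] at hx
    simp only [Finset.mem_union, Finset.mem_image, Finset.mem_range]
    rcases le_total 0 x with h | h
    · exact Or.inl ⟨x.natAbs, by omega, by omega⟩
    · exact Or.inr ⟨x.natAbs, by omega, by omega⟩
  refine (Finset.sum_le_sum_of_subset_of_nonneg h1 fun _ _ _ => hg _).trans ?_
  have h2 := Finset.sum_union_inter (s₁ := (Finset.range (t+1)).image (fun m : ℕ => (m:ℤ)))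
    (s₂ := (Finset.range (t+1)).image (fun m : ℕ => -(m:ℤ))) (f := fun x : ℤ => g x.natAbs)
  have h3 : 0 ≤ ∑ x ∈ (Finset.range (t+1)).image (fun m : ℕ => (m:ℤ)) ∩
    (Finset.range (t+1)).image (fun m : ℕ => -(m:ℤ)), g x.natAbs := Finset.sum_nonneg fun _ _ => hg _
  rw [Finset.sum_image (by intro a _ b _ hab; simpa using hab),
    Finset.sum_image (by intro a _ b _ hab; simpa using hab)] at h2
  simp only [Int.natAbs_neg, Int.natAbs_natCast] at h2
  linarith

lemma second_moment (t k : ℕ) (hk : 1 ≤ k) (h : ff (pc 1) t (8 * k) ≤ 1/2) :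
    ∑ x ∈ Finset.Icc (-(t:ℤ)) t, (x:ℝ) ^ 2 * ta (pc 1) t x ≤ (576 * k) ^ 2 * ch (pc 1) t +
      1024 * (168 * 2 ^ 36) ^ 2 * k ^ 2 * th (pc 1) t ^ 2 * (64 * k) := by
  set B : ℝ := 1024 * (168 * 2 ^ 36) ^ 2 * k ^ 2 * th (pc 1) t ^ 2 with hB
  have hB0 : 0 ≤ B := by positivity
  have h1 : ∑ x ∈ Finset.Icc (-(t:ℤ)) t, (x:ℝ) ^ 2 * ta (pc 1) t x ≤
      ∑ x ∈ Finset.Icc (-(t:ℤ)) t, ((576 * k) ^ 2 * ta (pc 1) t x + B * (1/2) ^ (x.natAbs / (16 * k))) := by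
    refine Finset.sum_le_sum fun x _ => ?_
    have hb := x_bound t k hk h x.natAbs
    have hx : ta (pc 1) t ((x.natAbs : ℕ) : ℤ) = ta (pc 1) t x := by
      rcases Int.natAbs_eq x with h | h
      · rw [← h]
      · conv_rhs => rw [h, ta_neg]
    have hx2 : ((x.natAbs : ℕ) : ℝ) ^ 2 = (x:ℝ) ^ 2 := by
      rw [Nat.cast_natAbs, Int.cast_abs, sq_abs]
    rw [hx, hx2] at hb
    exact hb
  refine h1.trans ?_
  rw [Finset.sum_add_distrib, ← Finset.mul_sum, ← Finset.mul_sum]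
  have h2 := abs_sum_le t (fun m => (1/2:ℝ) ^ (m / (16 * k))) (fun _ => by positivity)
  have h3 := geo_sum (16 * k) (by omega) (t+1)
  push_cast at h3
  have h4 : ∑ x ∈ Finset.Icc (-(t:ℤ)) t, (1/2:ℝ) ^ (x.natAbs / (16 * k)) ≤ 64 * k := by
    refine h2.trans ?_
    linarith
  have h5 := mul_le_mul_of_nonneg_left h4 hB0
  unfold ch
  linarith

lemma chi_eq (q : ℝ) (t : ℕ) : chi 1 q t = ch q t := by
  unfold chi ch
  simp only [tau_eq]
  rw [← (Equiv.funUnique (Fin 1) ℤ).symm.tsum_eq]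
  rw [tsum_eq_sum (s := Finset.Icc (-(t:ℤ)) t)]
  · rfl
  · intro x hx
    refine ta_zero q t ?_
    rw [Finset.mem_Icc] at hx
    change (t:ℤ) < |x|
    by_contra hlt
    exact hx (abs_le.1 (not_lt.1 hlt))

lemma sm_eq (q : ℝ) (t : ℕ) : ∑' x : Fin 1 → ℤ, (normSq x : ℝ) * tau 1 q x t =
    ∑ x ∈ Finset.Icc (-(t:ℤ)) t, (x:ℝ) ^ 2 * ta q t x := by
  simp only [tau_eq, normSq, Finset.univ_unique, Fin.default_eq_zero, Finset.sum_singleton]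
  rw [← (Equiv.funUnique (Fin 1) ℤ).symm.tsum_eq]
  rw [tsum_eq_sum (s := Finset.Icc (-(t:ℤ)) t)]
  · refine Finset.sum_congr rfl fun x _ => ?_
    change ((x ^ 2 : ℤ) : ℝ) * ta q t x = _
    push_cast; rfl
  · intro x hx
    refine mul_eq_zero_of_right _ (ta_zero q t ?_)
    rw [Finset.mem_Icc] at hx
    change (t:ℤ) < |x|
    by_contra hlt
    exact hx (abs_le.1 (not_lt.1 hlt))

lemma final_bound (t : ℕ) (C : ℝ) (hC : C = 576 ^ 2 + 1024 * (168 * 2 ^ 36) ^ 2 * 64 * 112896) :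
    1 / (112896 * Real.sqrt C) * xi 1 (pc 1) t * theta 1 (pc 1) t ^ 2 ≤ chi 1 (pc 1) t := by
  obtain ⟨k, hk, h1, h2⟩ := scale t
  have h3 := second_moment t k hk h1
  unfold xi
  rw [sm_eq, chi_eq, theta_eq]
  set S := ∑ x ∈ Finset.Icc (-(t:ℤ)) t, (x:ℝ) ^ 2 * ta (pc 1) t x with hS
  set c := ch (pc 1) t with hc
  set θ := th (pc 1) t with hθ
  have hc0 : 0 ≤ c := ch_nonneg _ _
  have hCpos : 0 < C := by rw [hC]; positivity
  have hsq : 0 < Real.sqrt C := Real.sqrt_pos.2 hCpos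
  have h4 : S ≤ C * k ^ 2 * c := by
    have h5 : (k:ℝ) ^ 2 * (k * θ ^ 2 * (1/112896)) ≤ k ^ 2 * c := mul_le_mul_of_nonneg_left h2 (by positivity)
    rw [hC]
    have h6 : 1024 * (168 * 2 ^ 36) ^ 2 * (k:ℝ) ^ 2 * θ ^ 2 * (64 * k) =
      (1024 * (168 * 2 ^ 36) ^ 2 * 64 * 112896) * ((k:ℝ) ^ 2 * (k * θ ^ 2 * (1/112896))) := by ring
    rw [h6] at h3
    have h7 := mul_le_mul_of_nonneg_left h5 (by positivity : (0:ℝ) ≤ 1024 * (168 * 2 ^ 36) ^ 2 * 64 * 112896)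
    nlinarith
  have h5 : S / c ≤ C * k ^ 2 := div_le_of_le_mul₀ hc0 (by positivity) h4
  have h6 : Real.sqrt (S / c) ≤ Real.sqrt C * k := by
    refine (Real.sqrt_le_sqrt h5).trans (le_of_eq ?_)
    rw [Real.sqrt_mul hCpos.le, Real.sqrt_sq (by positivity)]
  calc 1 / (112896 * Real.sqrt C) * Real.sqrt (S / c) * θ ^ 2
      ≤ 1 / (112896 * Real.sqrt C) * (Real.sqrt C * k) * θ ^ 2 := by gcongr
    _ = k * θ ^ 2 * (1/112896) := by field_simp
    _ ≤ c := h2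

/-- for `d = 1` at `p = p_c` there is a constant `K > 0` such that
`χ_t ≥ K ξ_t θ_t²` for all `t ≥ 1`. -/
theorem chi_lower_bound_dim_one : ∃ K : ℝ, 0 < K ∧ ∀ t : ℕ, 1 ≤ t →
    K * xi 1 (pc 1) t * theta 1 (pc 1) t ^ 2 ≤ chi 1 (pc 1) t := by
  refine ⟨_, ?_, fun t _ => final_bound t _ rfl⟩
  positivity

end OrientedPercolation
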